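/- If α is a left-c.e. real which is neither computable nor Martin-Löf random, then there exists a left-c.e. real β (which is also not Martin-Löf random) such that α − β is neither a left-c.e. real nor a right-c.e. real. -/

import Mathlib

open Filter

/-- A real is left-c.e. if it is the limit of an increasing computable sequence of rationals. -/
def LeftCE (α : ℝ) : Prop :=
  ∃ f : ℕ → ℚ, Computable f ∧ StrictMono f ∧
    Tendsto (fun n => (f n : ℝ)) atTop (nhds α)

/-- A real is right-c.e. if it is the limit of a decreasing computable sequence of rationals. -/
def RightCE (α : ℝ) : Prop :=
  ∃ f : ℕ → ℚ, Computable f ∧ StrictAnti f ∧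
    Tendsto (fun n => (f n : ℝ)) atTop (nhds α)

/-- A real is computable if a computable sequence of rationals approximates it with error `2⁻ⁿ`. -/
def ComputableReal (α : ℝ) : Prop :=
  ∃ f : ℕ → ℚ, Computable f ∧ ∀ n, |(f n : ℝ) - α| < (2 : ℝ)⁻¹ ^ n

/-- Martin-Löf randomness of a real, via interval Martin-Löf tests: a test is a computable
double sequence of rational intervals, where level `n` has total length at most `2⁻ⁿ`;
a random real escapes some level of every test. -/
def MLRandom (α : ℝ) : Prop :=
  ∀ U : ℕ → ℕ → ℚ × ℚ, Computable₂ U →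
    (∀ n : ℕ, ∑' i : ℕ, max (((U n i).2 : ℝ) - ((U n i).1 : ℝ)) 0 ≤ (2 : ℝ)⁻¹ ^ n) →
    ∃ n : ℕ, ∀ i : ℕ, ¬ (((U n i).1 : ℝ) < α ∧ α < ((U n i).2 : ℝ))

/-- A set of naturals is computably enumerable. -/
def CESet (A : Set ℕ) : Prop :=
  ∃ f : ℕ →. ℕ, Partrec f ∧ ∀ n, n ∈ A ↔ (f n).Dom

/-- The real in [0,1] whose binary expansion is the characteristic sequence of `A`. -/
noncomputable def realOfSet (A : Set ℕ) : ℝ :=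
  ∑' n : ℕ, Set.indicator A (fun n => (2 : ℝ)⁻¹ ^ (n + 1)) n

/-! ## Computability of rational arithmetic -/

section RatComp
open Encodable

theorem comp_of_unique {A : Type*} [Primcodable A] {f : A → ℕ} {p : A → ℕ → Bool}
    (hp : Computable₂ p) (h : ∀ a m, p a m = true ↔ m = f a) : Computable f := by
  have h1 : Partrec fun a => Nat.rfind (p a : ℕ →. Bool) := Partrec.rfind hp.partrec₂
  refine h1.of_eq fun a => ?_
  apply Part.eq_some_iff.2
  rw [Nat.mem_rfind]
  refine ⟨?_, fun {m} hm => ?_⟩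
  · have : p a (f a) = true := (h a (f a)).2 rfl
    simp [this]
  · have : p a m = false := by
      by_contra hc
      have := (h a m).1 (by simpa using hc)
      omega
    simp [this]

theorem comp_ite {A B : Type*} [Primcodable A] [Primcodable B] {c : A → Prop} [DecidablePred c]
    {f g : A → B} (hc : Computable (fun a => decide (c a))) (hf : Computable f)
    (hg : Computable g) : Computable (fun a => if c a then f a else g a) := by
  refine (Computable.cond hc hf hg).of_eq fun a => ?_
  by_cases h : c a <;> simp [h]

/-- The original (non-surjective) code of a rational. -/
def ratCode (q : ℚ) : ℕ := Nat.pair (encode q.num) q.den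

theorem ratCode_eq (q : ℚ) : ratCode q = @encode ℚ Rat.instEncodable q := rfl

theorem ratCode_inj : Function.Injective ratCode := fun _ _ h =>
  @encode_injective _ Rat.instEncodable _ _ h

/-- Positive part and negative part of the integer with code `n`. -/
def intP (n : ℕ) : ℕ := if n % 2 = 0 then n / 2 else 0
def intM (n : ℕ) : ℕ := if n % 2 = 0 then 0 else n / 2 + 1

theorem intP_encode (z : ℤ) : intP (encode z) = z.toNat := by
  rcases z with n | n
  · have : encode (Int.ofNat n) = 2 * n := rfl
    rw [this]; simp [intP]
  · have : encode (Int.negSucc n) = 2 * n + 1 := rfl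
    rw [this]; simp [intP]

theorem intM_encode (z : ℤ) : intM (encode z) = (-z).toNat := by
  rcases z with n | n
  · have : encode (Int.ofNat n) = 2 * n := rfl
    rw [this]; simp [intM]
  · have : encode (Int.negSucc n) = 2 * n + 1 := rfl
    rw [this]; simp only [intM]; rw [if_neg (by omega)]; omega

theorem primrec_intP : Primrec intP :=
  Primrec.ite (Primrec.eq.comp (Primrec.nat_mod.comp Primrec.id (Primrec.const 2)) (Primrec.const 0))
    (Primrec.nat_div.comp Primrec.id (Primrec.const 2)) (Primrec.const 0)

theorem primrec_intM : Primrec intM :=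
  Primrec.ite (Primrec.eq.comp (Primrec.nat_mod.comp Primrec.id (Primrec.const 2)) (Primrec.const 0))
    (Primrec.const 0) (Primrec.succ.comp (Primrec.nat_div.comp Primrec.id (Primrec.const 2)))

theorem primrec_dvd : PrimrecRel (fun a b : ℕ => b % a = 0) :=
  Primrec.eq.comp (Primrec.nat_mod.comp Primrec.snd Primrec.fst) (Primrec.const 0)

/-- Being a code of a rational, in a visibly primitive recursive form. -/
def IsRatCode (m : ℕ) : Prop :=
  0 < m.unpair.2 ∧ ∀ k < m.unpair.2 + 1, k ≤ 1 ∨ ¬ ((intP m.unpair.1 + intM m.unpair.1) % k = 0) ∨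
    ¬ (m.unpair.2 % k = 0)

instance : DecidablePred IsRatCode := fun m => by unfold IsRatCode; infer_instance

theorem isRatCode_iff (m : ℕ) : IsRatCode m ↔ m ∈ Set.range ratCode := by
  constructor
  · rintro ⟨h0, h⟩
    set a : ℤ := Denumerable.ofNat ℤ m.unpair.1 with ha
    have hea : encode a = m.unpair.1 := Denumerable.encode_ofNat _
    have hab : intP m.unpair.1 + intM m.unpair.1 = a.natAbs := by
      rw [← hea, intP_encode, intM_encode]; omega
    have hc : a.natAbs.Coprime m.unpair.2 := by
      rw [hab] at h
      by_contra hc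
      have hpos : 0 < Nat.gcd a.natAbs m.unpair.2 := Nat.gcd_pos_of_pos_right _ h0
      have hle : Nat.gcd a.natAbs m.unpair.2 ≤ m.unpair.2 := Nat.gcd_le_right _ h0
      rcases h (Nat.gcd a.natAbs m.unpair.2) (by omega) with h1 | h1 | h1
      · exact hc (by unfold Nat.Coprime; omega)
      · exact h1 (Nat.mod_eq_zero_of_dvd (Nat.gcd_dvd_left _ _))
      · exact h1 (Nat.mod_eq_zero_of_dvd (Nat.gcd_dvd_right _ _))
    refine ⟨⟨a, m.unpair.2, by omega, hc⟩, ?_⟩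
    simp only [ratCode]
    rw [hea, Nat.pair_unpair]
  · rintro ⟨q, rfl⟩
    unfold IsRatCode ratCode
    simp only [Nat.unpair_pair, intP_encode, intM_encode]
    refine ⟨q.den_pos, fun k hk => ?_⟩
    by_contra hc
    push Not at hc
    obtain ⟨h1, h2, h3⟩ := hc
    have e : q.num.toNat + (-q.num).toNat = q.num.natAbs := by omega
    rw [e] at h2
    have := Nat.dvd_gcd (Nat.dvd_of_mod_eq_zero h2) (Nat.dvd_of_mod_eq_zero h3)
    rw [q.reduced] at this
    have := Nat.le_of_dvd one_pos this
    omega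

theorem primrec_isRatCode : PrimrecPred IsRatCode := by
  have hun2 : Primrec (fun m : ℕ => m.unpair.2) := Primrec.snd.comp Primrec.unpair
  have hun1 : Primrec (fun m : ℕ => m.unpair.1) := Primrec.fst.comp Primrec.unpair
  have hR : PrimrecRel (fun k m : ℕ => k ≤ 1 ∨ ¬ ((intP m.unpair.1 + intM m.unpair.1) % k = 0) ∨
    ¬ (m.unpair.2 % k = 0)) := by
    refine PrimrecPred.or (Primrec.nat_le.comp Primrec.fst (Primrec.const 1)) (PrimrecPred.or ?_ ?_)
    · refine PrimrecPred.not (primrec_dvd.comp Primrec.fst ?_)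
      exact Primrec.nat_add.comp (primrec_intP.comp (hun1.comp Primrec.snd))
        (primrec_intM.comp (hun1.comp Primrec.snd))
    · exact PrimrecPred.not (primrec_dvd.comp Primrec.fst (hun2.comp Primrec.snd))
  exact PrimrecPred.and (Primrec.nat_lt.comp (Primrec.const 0) hun2)
    (hR.forall_lt.comp (Primrec.succ.comp hun2) Primrec.id)

theorem primrec_count : Primrec (Nat.count IsRatCode) := by
  have h : Primrec (fun n : ℕ => (Nat.rec 0 (fun y ih => ih + if IsRatCode y then 1 else 0) n : ℕ)) := by
    refine Primrec.nat_rec₁ 0 (f := fun y ih => ih + if IsRatCode y then 1 else 0) ?_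
    exact Primrec.nat_add.comp Primrec.snd
      (Primrec.ite (primrec_isRatCode.comp Primrec.fst) (Primrec.const 1) (Primrec.const 0))
  refine h.of_eq fun n => ?_
  induction n with
  | zero => simp
  | succ n ih => rw [Nat.count_succ, ← ih]

theorem encode_rat (q : ℚ) :
    @encode ℚ Primcodable.toEncodable q = Nat.count IsRatCode (ratCode q) := by
  have h : @encode ℚ Primcodable.toEncodable q = @List.countP ℕ (fun x =>
      @decide (x ∈ Set.range ratCode)
        ((@Encodable.decidableRangeEncode ℚ Rat.instEncodable) x)) (List.range (ratCode q)) := rfl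
  rw [h, Nat.count]
  congr 1
  funext x
  exact decide_eq_decide.2 (isRatCode_iff x).symm

theorem computable_ratCode : Computable ratCode := by
  refine comp_of_unique
    (p := fun q m => decide (IsRatCode m) &&
      decide (Nat.count IsRatCode m = @encode ℚ Primcodable.toEncodable q)) ?_ ?_
  · refine Primrec.to_comp (Primrec.and.comp ?_ ?_)
    · exact (primrec_isRatCode.comp Primrec.snd).decide
    · exact (Primrec.eq.comp (primrec_count.comp Primrec.snd)
        (Primrec.encode.comp Primrec.fst)).decide
  · intro q m
    simp only [Bool.and_eq_true, decide_eq_true_eq, encode_rat]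
    constructor
    · rintro ⟨h1, h2⟩
      exact Nat.count_injective h1 ((isRatCode_iff _).2 ⟨q, rfl⟩) h2
    · rintro rfl
      exact ⟨(isRatCode_iff _).2 ⟨q, rfl⟩, rfl⟩

def ratP (q : ℚ) : ℕ := q.num.toNat
def ratM (q : ℚ) : ℕ := (-q.num).toNat
def ratD (q : ℚ) : ℕ := q.den

theorem computable_ratP : Computable ratP := by
  refine ((primrec_intP.comp (Primrec.fst.comp Primrec.unpair)).to_comp.comp
    computable_ratCode).of_eq fun q => ?_
  simp [ratCode, intP_encode, ratP]

theorem computable_ratM : Computable ratM := by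
  refine ((primrec_intM.comp (Primrec.fst.comp Primrec.unpair)).to_comp.comp
    computable_ratCode).of_eq fun q => ?_
  simp [ratCode, intM_encode, ratM]

theorem computable_ratD : Computable ratD := by
  refine ((Primrec.snd.comp Primrec.unpair).to_comp.comp
    computable_ratCode).of_eq fun q => ?_
  simp [ratCode, ratD]

theorem rat_eq (q : ℚ) : q = ((ratP q : ℚ) - ratM q) / ratD q := by
  have h : (q.num : ℚ) = (ratP q : ℚ) - ratM q := by
    have : q.num = (ratP q : ℤ) - ratM q := by unfold ratP ratM; omega
    exact_mod_cast this
  rw [← h]; exact (Rat.num_div_den q).symm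

theorem ratD_pos (q : ℚ) : (0 : ℚ) < ratD q := by exact_mod_cast q.den_pos

theorem comp_rat_of_test {A : Type*} [Primcodable A] {f : A → ℚ} {p : A → ℚ → Bool}
    (hp : Computable₂ p) (h : ∀ a q, p a q = true ↔ q = f a) : Computable f := by
  have h1 : Computable (fun a => @encode ℚ Primcodable.toEncodable (f a)) := by
    refine comp_of_unique (p := fun a m => p a (Denumerable.ofNat ℚ m)) ?_ ?_
    · exact hp.comp Computable.fst ((Primrec.ofNat ℚ).to_comp.comp Computable.snd)
    · intro a m
      rw [h]
      constructor
      · intro e; rw [← e]; exact (Denumerable.encode_ofNat m).symm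
      · rintro rfl; exact Denumerable.ofNat_encode (f a)
  exact Computable.encode_iff.1 h1

variable {A : Type*} [Primcodable A]

theorem nadd {f g : A → ℕ} (hf : Computable f) (hg : Computable g) :
    Computable fun a => f a + g a := Primrec.nat_add.to_comp.comp hf hg
theorem nmul {f g : A → ℕ} (hf : Computable f) (hg : Computable g) :
    Computable fun a => f a * g a := Primrec.nat_mul.to_comp.comp hf hg
theorem neqd {f g : A → ℕ} (hf : Computable f) (hg : Computable g) :
    Computable fun a => decide (f a = g a) := by
  have : Primrec₂ (fun a b : ℕ => decide (a = b)) := (Primrec.eq (α := ℕ)).decide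
  exact this.to_comp.comp hf hg
theorem nltd {f g : A → ℕ} (hf : Computable f) (hg : Computable g) :
    Computable fun a => decide (f a < g a) := by
  have : Primrec₂ (fun a b : ℕ => decide (a < b)) := Primrec.nat_lt.decide
  exact this.to_comp.comp hf hg

theorem qlt_iff (x y : ℚ) : ratP x * ratD y + ratM y * ratD x < ratP y * ratD x + ratM x * ratD y ↔
    x < y := by
  conv_rhs => rw [rat_eq x, rat_eq y]
  rw [div_lt_div_iff₀ (ratD_pos x) (ratD_pos y)]
  rw [← Nat.cast_lt (α := ℚ)]
  push_cast
  constructor <;> intro h <;> nlinarith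

theorem qltd {f g : A → ℚ} (hf : Computable f) (hg : Computable g) :
    Computable fun a => decide (f a < g a) := by
  have : Computable fun a => decide (ratP (f a) * ratD (g a) + ratM (g a) * ratD (f a)
      < ratP (g a) * ratD (f a) + ratM (f a) * ratD (g a)) := by
    have h1 := computable_ratP.comp hf
    have h2 := computable_ratM.comp hf
    have h3 := computable_ratD.comp hf
    have h4 := computable_ratP.comp hg
    have h5 := computable_ratM.comp hg
    have h6 := computable_ratD.comp hg
    exact nltd (nadd (nmul h1 h6) (nmul h5 h3)) (nadd (nmul h4 h3) (nmul h2 h6))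
  exact this.of_eq fun a => decide_eq_decide.2 (qlt_iff _ _)

theorem qsub {f g : A → ℚ} (hf : Computable f) (hg : Computable g) :
    Computable fun a => f a - g a := by
  refine comp_rat_of_test (p := fun a q => decide
    ((ratP (f a) * ratD (g a) + ratM (g a) * ratD (f a)) * ratD q + ratM q * (ratD (f a) * ratD (g a)) =
     (ratM (f a) * ratD (g a) + ratP (g a) * ratD (f a)) * ratD q + ratP q * (ratD (f a) * ratD (g a)))) ?_ ?_
  · have h1 := computable_ratP.comp (hf.comp (Computable.fst (α := A) (β := ℚ)))
    have h2 := computable_ratM.comp (hf.comp (Computable.fst (α := A) (β := ℚ)))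
    have h3 := computable_ratD.comp (hf.comp (Computable.fst (α := A) (β := ℚ)))
    have h4 := computable_ratP.comp (hg.comp (Computable.fst (α := A) (β := ℚ)))
    have h5 := computable_ratM.comp (hg.comp (Computable.fst (α := A) (β := ℚ)))
    have h6 := computable_ratD.comp (hg.comp (Computable.fst (α := A) (β := ℚ)))
    have h7 := computable_ratP.comp (Computable.snd (α := A) (β := ℚ))
    have h8 := computable_ratM.comp (Computable.snd (α := A) (β := ℚ))
    have h9 := computable_ratD.comp (Computable.snd (α := A) (β := ℚ))
    exact neqd (nadd (nmul (nadd (nmul h1 h6) (nmul h5 h3)) h9) (nmul h8 (nmul h3 h6)))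
      (nadd (nmul (nadd (nmul h2 h6) (nmul h4 h3)) h9) (nmul h7 (nmul h3 h6)))
  · intro a q
    rw [decide_eq_true_eq]
    generalize f a = x
    generalize g a = y
    conv_rhs => rw [rat_eq x, rat_eq y, rat_eq q]
    have hx := ratD_pos x
    have hy := ratD_pos y
    have hq := ratD_pos q
    rw [div_sub_div _ _ hx.ne' hy.ne', div_eq_div_iff hq.ne' (by positivity)]
    rw [← Nat.cast_inj (R := ℚ)]
    push_cast
    constructor <;> intro h <;> linear_combination -h

theorem qadd {f g : A → ℚ} (hf : Computable f) (hg : Computable g) :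
    Computable fun a => f a + g a :=
  (qsub hf (qsub (Computable.const 0) hg)).of_eq fun a => by ring

theorem qmul {f g : A → ℚ} (hf : Computable f) (hg : Computable g) :
    Computable fun a => f a * g a := by
  refine comp_rat_of_test (p := fun a q => decide
    ((ratP (f a) * ratP (g a) + ratM (f a) * ratM (g a)) * ratD q + ratM q * (ratD (f a) * ratD (g a)) =
     (ratM (f a) * ratP (g a) + ratP (f a) * ratM (g a)) * ratD q + ratP q * (ratD (f a) * ratD (g a)))) ?_ ?_
  · have h1 := computable_ratP.comp (hf.comp (Computable.fst (α := A) (β := ℚ)))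
    have h2 := computable_ratM.comp (hf.comp (Computable.fst (α := A) (β := ℚ)))
    have h3 := computable_ratD.comp (hf.comp (Computable.fst (α := A) (β := ℚ)))
    have h4 := computable_ratP.comp (hg.comp (Computable.fst (α := A) (β := ℚ)))
    have h5 := computable_ratM.comp (hg.comp (Computable.fst (α := A) (β := ℚ)))
    have h6 := computable_ratD.comp (hg.comp (Computable.fst (α := A) (β := ℚ)))
    have h7 := computable_ratP.comp (Computable.snd (α := A) (β := ℚ))
    have h8 := computable_ratM.comp (Computable.snd (α := A) (β := ℚ))
    have h9 := computable_ratD.comp (Computable.snd (α := A) (β := ℚ))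
    exact neqd (nadd (nmul (nadd (nmul h1 h4) (nmul h2 h5)) h9) (nmul h8 (nmul h3 h6)))
      (nadd (nmul (nadd (nmul h2 h4) (nmul h1 h5)) h9) (nmul h7 (nmul h3 h6)))
  · intro a q
    rw [decide_eq_true_eq]
    generalize f a = x
    generalize g a = y
    conv_rhs => rw [rat_eq x, rat_eq y, rat_eq q]
    have hx := ratD_pos x
    have hy := ratD_pos y
    have hq := ratD_pos q
    rw [div_mul_div_comm, div_eq_div_iff hq.ne' (by positivity)]
    rw [← Nat.cast_inj (R := ℚ)]
    push_cast
    constructor <;> intro h <;> linear_combination -h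

theorem qled {f g : A → ℚ} (hf : Computable f) (hg : Computable g) :
    Computable fun a => decide (f a ≤ g a) :=
  (Primrec.not.to_comp.comp (qltd hg hf)).of_eq fun a => by simp [← not_lt]

theorem qmin {f g : A → ℚ} (hf : Computable f) (hg : Computable g) :
    Computable fun a => min (f a) (g a) :=
  (comp_ite (qled hf hg) hf hg).of_eq fun a => (min_def _ _).symm

theorem qpow (c : ℚ) {f : A → ℕ} (hf : Computable f) : Computable fun a => c ^ f a := by
  have : Computable fun a => (Nat.rec (1 : ℚ) (fun _ ih => ih * c) (f a) : ℚ) :=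
    Computable.nat_rec (h := fun _ p => p.2 * c) hf (Computable.const 1)
      (qmul (Computable.snd.comp Computable.snd) (Computable.const c))
  refine this.of_eq fun a => ?_
  induction f a with
  | zero => simp
  | succ n ih => rw [pow_succ, ← ih]

theorem qcast {f : A → ℕ} (hf : Computable f) : Computable fun a => (f a : ℚ) := by
  have : Computable fun a => (Nat.rec (0 : ℚ) (fun _ ih => ih + 1) (f a) : ℚ) :=
    Computable.nat_rec (h := fun _ p => p.2 + 1) hf (Computable.const 0)
      (qadd (Computable.snd.comp Computable.snd) (Computable.const 1))
  refine this.of_eq fun a => ?_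
  induction f a with
  | zero => simp
  | succ n ih => rw [Nat.cast_succ, ← ih]

end RatComp

/-! ## Basic facts on left-c.e. reals -/

section Basic
open Encodable

theorem not_mlrandom (β : ℝ) : ¬ MLRandom β := by
  intro h
  have hU : Computable₂ (fun _ i : ℕ => ((0 - ((i : ℚ) + 1), (i : ℚ) + 1) : ℚ × ℚ)) := by
    have h1 : Computable (fun p : ℕ × ℕ => (p.2 : ℚ) + 1) :=
      qadd (qcast Computable.snd) (Computable.const 1)
    exact Computable.pair (qsub (Computable.const 0) h1) h1
  obtain ⟨n, hn⟩ := h (fun _ i => (0 - ((i : ℚ) + 1), (i : ℚ) + 1)) hU (by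
    intro n
    rw [tsum_eq_zero_of_not_summable]
    · positivity
    · intro hs
      have h0 := hs.tendsto_atTop_zero
      have := h0.eventually (gt_mem_nhds (show (0 : ℝ) < 1 by norm_num))
      obtain ⟨i, hi⟩ := this.exists
      push_cast at hi
      have h2 := le_max_left ((i : ℝ) + 1 - (0 - ((i : ℝ) + 1))) 0
      have : (0 : ℝ) ≤ i := Nat.cast_nonneg i
      linarith)
  obtain ⟨i, hi⟩ := exists_nat_gt |β|
  refine hn i ⟨?_, ?_⟩
  · push_cast
    have := neg_abs_le β
    linarith
  · push_cast
    have := le_abs_self β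
    linarith

theorem tendsto_half : Tendsto (fun n : ℕ => (((1 / 2 : ℚ) ^ n : ℚ) : ℝ)) atTop (nhds 0) := by
  push_cast
  exact tendsto_pow_atTop_nhds_zero_of_lt_one (by norm_num) (by norm_num)

theorem leftCE_of_mono {f : ℕ → ℚ} {x : ℝ} (hf : Computable f) (hm : Monotone f)
    (ht : Tendsto (fun n => (f n : ℝ)) atTop (nhds x)) : LeftCE x := by
  refine ⟨fun n => f n - (1 / 2) ^ n, qsub hf (qpow _ Computable.id), ?_, ?_⟩
  · refine strictMono_nat_of_lt_succ fun n => ?_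
    have h1 := hm (Nat.le_succ n)
    have h2 : (0 : ℚ) < (1 / 2) ^ n := by positivity
    rw [pow_succ]
    simp only [Nat.succ_eq_add_one] at h1
    linarith
  · have := ht.sub tendsto_half
    simp only [sub_zero] at this
    exact this.congr fun n => by push_cast; ring

theorem exists_search {p : ℕ → ℕ → Bool} (hp : Computable₂ p) (h : ∀ n, ∃ t, p n t = true) :
    ∃ g : ℕ → ℕ, Computable g ∧ ∀ n, p n (g n) = true := by
  have h1 : Partrec fun a => Nat.rfind (p a : ℕ →. Bool) := Partrec.rfind hp.partrec₂
  refine ⟨fun n => Nat.find (h n), ?_, fun n => Nat.find_spec (h n)⟩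
  refine h1.of_eq fun a => ?_
  apply Part.eq_some_iff.2
  rw [Nat.mem_rfind]
  refine ⟨?_, fun {m} hm => ?_⟩
  · have : p a (Nat.find (h a)) = true := Nat.find_spec (h a)
    simp [this]
  · have : p a m = false := by
      have := Nat.find_min (h a) hm
      simpa using this
    simp [this]

theorem computable_of_upper {α : ℝ} {a u : ℕ → ℚ} (ha : Computable a) (hu : Computable u)
    (h1 : ∀ t, (a t : ℝ) ≤ α) (h2 : ∀ t, α ≤ u t) (h3 : ∀ ε : ℚ, 0 < ε → ∃ t, u t - a t < ε) :
    ComputableReal α := by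
  obtain ⟨g, hg, hgs⟩ := exists_search (p := fun n t => decide (u t - a t < (1 / 2) ^ n)) 
    (qltd (qsub (hu.comp Computable.snd) (ha.comp Computable.snd)) (qpow _ Computable.fst))
    (fun n => by
      obtain ⟨t, ht⟩ := h3 ((1 / 2) ^ n) (by positivity)
      exact ⟨t, by simpa using ht⟩)
  refine ⟨fun n => a (g n), ha.comp hg, fun n => ?_⟩
  have h4 : u (g n) - a (g n) < (1 / 2) ^ n := of_decide_eq_true (hgs n)
  have h5 : (u (g n) : ℝ) - a (g n) < (2 : ℝ)⁻¹ ^ n := by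
    have : ((u (g n) - a (g n) : ℚ) : ℝ) < (((1 / 2) ^ n : ℚ) : ℝ) := by exact_mod_cast h4
    push_cast at this
    simpa using this
  rw [abs_sub_comm, abs_of_nonneg (by linarith [h1 (g n)])]
  linarith [h2 (g n)]

/-- A computable rational is a computable real. -/
theorem computableReal_rat (q : ℚ) : ComputableReal q :=
  ⟨fun _ => q, Computable.const q, fun n => by simp⟩

/-! ### Universal antitone sequences -/

open Nat.Partrec (Code)

def psiV (e t : ℕ) : ℚ :=
  ((Code.evaln t.unpair.1 (Denumerable.ofNat Code e.unpair.2) t.unpair.2).map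
    (Denumerable.ofNat ℚ)).getD (Denumerable.ofNat ℚ e.unpair.1)

def psi (e t : ℕ) : ℚ :=
  Nat.rec (Denumerable.ofNat ℚ e.unpair.1) (fun s ih => min ih (psiV e s)) t

theorem psi_zero (e : ℕ) : psi e 0 = Denumerable.ofNat ℚ e.unpair.1 := rfl
theorem psi_succ (e t : ℕ) : psi e (t + 1) = min (psi e t) (psiV e t) := rfl

theorem computable_psiV : Computable₂ psiV := by
  have hu1 : Primrec (fun m : ℕ => m.unpair.1) := Primrec.fst.comp Primrec.unpair
  have hu2 : Primrec (fun m : ℕ => m.unpair.2) := Primrec.snd.comp Primrec.unpair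
  have h1 : Primrec (fun p : ℕ × ℕ =>
      Code.evaln p.2.unpair.1 (Denumerable.ofNat Code p.1.unpair.2) p.2.unpair.2) :=
    Code.primrec_evaln.comp (Primrec.pair (Primrec.pair (hu1.comp Primrec.snd)
      ((Primrec.ofNat Code).comp (hu2.comp Primrec.fst))) (hu2.comp Primrec.snd))
  have h2 : Primrec (fun p : ℕ × ℕ =>
      (Code.evaln p.2.unpair.1 (Denumerable.ofNat Code p.1.unpair.2) p.2.unpair.2).map 
        (Denumerable.ofNat ℚ)) :=
    Primrec.option_map h1 ((Primrec.ofNat ℚ).comp Primrec.snd)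
  exact (Primrec.option_getD.comp h2 ((Primrec.ofNat ℚ).comp (hu1.comp Primrec.fst))).to_comp

theorem computable_psi : Computable₂ psi := by
  refine Computable.nat_rec (f := fun p : ℕ × ℕ => p.2) 
    (g := fun p => Denumerable.ofNat ℚ p.1.unpair.1) 
    (h := fun p s => min s.2 (psiV p.1 s.1)) Computable.snd ?_ ?_
  · exact (Primrec.ofNat ℚ).to_comp.comp (Computable.fst.comp (Computable.unpair.comp Computable.fst))
  · exact qmin (Computable.snd.comp Computable.snd) 
      (computable_psiV.comp (Computable.fst.comp Computable.fst) (Computable.fst.comp Computable.snd))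

theorem psi_antitone (e : ℕ) : Antitone (psi e) :=
  antitone_nat_of_succ_le fun t => by rw [psi_succ]; exact min_le_left _ _

theorem psi_spec {f : ℕ → ℚ} {x : ℝ} (hf : Computable f) (ha : Antitone f)
    (ht : Tendsto (fun n => (f n : ℝ)) atTop (nhds x)) :
    ∃ e, (∀ t, x ≤ psi e t) ∧ Tendsto (fun t => (psi e t : ℝ)) atTop (nhds x) := by
  have hc : Computable (fun n => @encode ℚ Primcodable.toEncodable (f n)) := Computable.encode.comp hf
  obtain ⟨c, hcc⟩ := Code.exists_code.1 (Partrec.nat_iff.1 hc.partrec)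
  have hx : ∀ n, x ≤ f n := fun n => by
    have ha' : Antitone (fun n => (f n : ℝ)) := fun a b h => Rat.cast_le.2 (ha h)
    exact ha'.le_of_tendsto ht n
  have hd : ∀ q : ℚ, Denumerable.ofNat ℚ (@encode ℚ Primcodable.toEncodable q) = q := fun q =>
    Denumerable.ofNat_encode q
  set e := Nat.pair (@encode ℚ Primcodable.toEncodable (f 0)) (encode c) with he
  have he1 : Denumerable.ofNat ℚ e.unpair.1 = f 0 := by simp [he]; exact hd _
  have he2 : Denumerable.ofNat Code e.unpair.2 = c := by simp [he]
  have hv : ∀ k y, psiV e (Nat.pair k y) = f 0 ∨ psiV e (Nat.pair k y) = f y := by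
    intro k y
    unfold psiV
    rw [he1, he2, Nat.unpair_pair]
    rcases hE : Code.evaln k c y with _ | v
    · simp
    · right
      have := Code.evaln_sound (c := c) (k := k) (n := y) (x := v) hE
      rw [hcc] at this
      simp at this
      simp [this]
      exact hd _
  have hw : ∀ y, ∃ k, psiV e (Nat.pair k y) = f y := by
    intro y
    have : @encode ℚ Primcodable.toEncodable (f y) ∈ c.eval y := by rw [hcc]; simp
    obtain ⟨k, hk⟩ := Code.evaln_complete.1 this
    refine ⟨k, ?_⟩
    unfold psiV
    rw [he1, he2, Nat.unpair_pair]
    simp only []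
    rw [Option.mem_def.1 hk]
    simp
    exact hd _
  have hlow : ∀ t, x ≤ psi e t := by
    intro t
    induction t with
    | zero => rw [psi_zero, he1]; exact hx 0
    | succ t ih =>
      rw [psi_succ]
      push_cast
      refine le_min ih ?_
      have := hv t.unpair.1 t.unpair.2
      rw [Nat.pair_unpair] at this
      rcases this with h | h <;> rw [h] <;> exact hx _
  refine ⟨e, hlow, ?_⟩
  refine tendsto_order.2 ⟨fun y hy => Eventually.of_forall fun t => hy.trans_le (hlow t), fun y hy => ?_⟩
  obtain ⟨n, hn⟩ := ((tendsto_order.1 ht).2 y hy).exists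
  obtain ⟨k, hk⟩ := hw n
  filter_upwards [eventually_ge_atTop (Nat.pair k n + 1)] with t htt
  have h1 := psi_antitone e htt
  have h2 : psi e (Nat.pair k n + 1) ≤ f n := by rw [psi_succ, hk]; exact min_le_right _ _
  have h3 : (psi e t : ℝ) ≤ f n := by exact_mod_cast h1.trans h2
  linarith

end Basic

/-! ## The construction -/

section Construction

abbrev CState := ℚ × List (ℕ × ℕ) × List (ℕ × ℚ)

/-- Last logged event time of an index below `j`. -/
def lev (E : List (ℕ × ℕ)) (j : ℕ) : ℕ :=
  E.foldr (fun p acc => if p.1 < j then p.2 else acc) 0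

/-- Last logged value for index `j`, with default value `q`. -/
def lookQ (q : ℚ) (E : List (ℕ × ℚ)) (j : ℕ) : ℚ :=
  E.foldr (fun p acc => if p.1 = j then p.2 else acc) q

theorem computable_lev : Computable₂ lev := by
  refine Primrec.to_comp ?_
  refine Primrec.list_foldr (f := fun p : List (ℕ × ℕ) × ℕ => p.1) (g := fun _ => 0)
    (h := fun p s => if s.1.1 < p.2 then s.1.2 else s.2) Primrec.fst (Primrec.const 0) ?_
  refine Primrec.ite (Primrec.nat_lt.comp (Primrec.fst.comp (Primrec.fst.comp Primrec.snd)) 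
    (Primrec.snd.comp Primrec.fst)) (Primrec.snd.comp (Primrec.fst.comp Primrec.snd))
    (Primrec.snd.comp Primrec.snd)

theorem computable_lookQ (q : ℚ) : Computable₂ (lookQ q) := by
  refine Primrec.to_comp ?_
  refine Primrec.list_foldr (f := fun p : List (ℕ × ℚ) × ℕ => p.1) (g := fun _ => q)
    (h := fun p s => if s.1.1 = p.2 then s.1.2 else s.2) Primrec.fst (Primrec.const q) ?_
  refine Primrec.ite (Primrec.eq.comp (Primrec.fst.comp (Primrec.fst.comp Primrec.snd)) 
    (Primrec.snd.comp Primrec.fst)) (Primrec.snd.comp (Primrec.fst.comp Primrec.snd))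
    (Primrec.snd.comp Primrec.snd)

variable (a : ℕ → ℚ) (R : ℕ → ℕ → ℚ)

/-- The index treated at stage `t`. -/
def ix (t : ℕ) : ℕ := t.unpair.1

def rv (t : ℕ) (st : CState) : ℚ := R (lev st.2.1 (ix t) + ix t) t

def actC (t : ℕ) (st : CState) : Bool :=
  (decide (lookQ (a 0 - 1) st.2.2 (ix t) < a t) && decide (a t < rv R t st)) &&
    decide (a t - st.1 - (rv R t st - a t) < 0 - psi (ix t) t)

def evC (t : ℕ) (st : CState) : Bool :=
  decide (psi (ix t) t - (a t - st.1) < (1 / 2) ^ (lev st.2.1 (ix t + 1))) &&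
  decide ((a t - st.1) - psi (ix t) t < (1 / 2) ^ (lev st.2.1 (ix t + 1)))

def stepC (t : ℕ) (st : CState) : CState :=
  (bif actC a R t st then st.1 + 2 * (rv R t st - a t) else st.1,
   bif evC a t st then (ix t, t) :: st.2.1 else st.2.1,
   bif actC a R t st then (ix t, rv R t st) :: st.2.2 else st.2.2)

def stC (t : ℕ) : CState := Nat.rec (0, [], []) (fun t st => stepC a R t st) t

def Bt (t : ℕ) : ℚ := (stC a R t).1
def Lt (t j : ℕ) : ℕ := lev (stC a R t).2.1 j
def Qt (t j : ℕ) : ℚ := lookQ (a 0 - 1) (stC a R t).2.2 j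
def Act (t : ℕ) : Bool := actC a R t (stC a R t)
def Ev (t : ℕ) : Bool := evC a t (stC a R t)
def Rt (t : ℕ) : ℚ := R (Lt a R t (ix t) + ix t) t

theorem computable_ix : Computable ix := Computable.fst.comp Computable.unpair

variable {a R}

theorem computable_rv (hR : Computable₂ R) : Computable₂ (rv R) := by
  have h1 : Computable (fun p : ℕ × CState => ix p.1) := computable_ix.comp Computable.fst
  have hE : Computable (fun p : ℕ × CState => p.2.2.1) :=
    Computable.fst.comp (Computable.snd.comp Computable.snd)
  exact hR.comp (nadd (computable_lev.comp hE h1) h1) Computable.fst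

theorem computable_actC (ha : Computable a) (hR : Computable₂ R) : Computable₂ (actC a R) := by
  have h1 : Computable (fun p : ℕ × CState => ix p.1) := computable_ix.comp Computable.fst
  have hB : Computable (fun p : ℕ × CState => p.2.1) := Computable.fst.comp Computable.snd
  have hQ : Computable (fun p : ℕ × CState => p.2.2.2) :=
    Computable.snd.comp (Computable.snd.comp Computable.snd)
  have hat : Computable (fun p : ℕ × CState => a p.1) := ha.comp Computable.fst
  have hrv : Computable (fun p : ℕ × CState => rv R p.1 p.2) := computable_rv hR
  have hps : Computable (fun p : ℕ × CState => psi (ix p.1) p.1) :=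
    computable_psi.comp h1 Computable.fst
  exact Primrec.and.to_comp.comp (Primrec.and.to_comp.comp
    (qltd ((computable_lookQ _).comp hQ h1) hat) (qltd hat hrv))
    (qltd (qsub (qsub hat hB) (qsub hrv hat)) (qsub (Computable.const 0) hps))

theorem computable_evC (ha : Computable a) : Computable₂ (evC a) := by
  have h1 : Computable (fun p : ℕ × CState => ix p.1) := computable_ix.comp Computable.fst
  have hB : Computable (fun p : ℕ × CState => p.2.1) := Computable.fst.comp Computable.snd
  have hE : Computable (fun p : ℕ × CState => p.2.2.1) :=
    Computable.fst.comp (Computable.snd.comp Computable.snd)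
  have hat : Computable (fun p : ℕ × CState => a p.1) := ha.comp Computable.fst
  have hps : Computable (fun p : ℕ × CState => psi (ix p.1) p.1) :=
    computable_psi.comp h1 Computable.fst
  have hp : Computable (fun p : ℕ × CState => (1 / 2 : ℚ) ^ (lev p.2.2.1 (ix p.1 + 1))) :=
    qpow _ (computable_lev.comp hE (nadd h1 (Computable.const 1)))
  exact Primrec.and.to_comp.comp (qltd (qsub hps (qsub hat hB)) hp)
    (qltd (qsub (qsub hat hB) hps) hp)

theorem computable_stepC (ha : Computable a) (hR : Computable₂ R) : Computable₂ (stepC a R) := by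
  have h1 : Computable (fun p : ℕ × CState => ix p.1) := computable_ix.comp Computable.fst
  have hB : Computable (fun p : ℕ × CState => p.2.1) := Computable.fst.comp Computable.snd
  have hE : Computable (fun p : ℕ × CState => p.2.2.1) :=
    Computable.fst.comp (Computable.snd.comp Computable.snd)
  have hQ : Computable (fun p : ℕ × CState => p.2.2.2) :=
    Computable.snd.comp (Computable.snd.comp Computable.snd)
  have hat : Computable (fun p : ℕ × CState => a p.1) := ha.comp Computable.fst
  have hrv : Computable (fun p : ℕ × CState => rv R p.1 p.2) := computable_rv hR
  have hA : Computable (fun p : ℕ × CState => actC a R p.1 p.2) := computable_actC ha hR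
  have hV : Computable (fun p : ℕ × CState => evC a p.1 p.2) := computable_evC ha
  refine Computable.pair (Computable.cond hA (qadd hB (qmul (Computable.const 2) (qsub hrv hat))) hB)
    (Computable.pair (Computable.cond hV ?_ hE) (Computable.cond hA ?_ hQ))
  · exact Computable.list_cons.comp (Computable.pair h1 Computable.fst) hE
  · exact Computable.list_cons.comp (Computable.pair h1 hrv) hQ

theorem computable_stC (ha : Computable a) (hR : Computable₂ R) : Computable (stC a R) := by
  refine Computable.nat_rec (f := fun t : ℕ => t) (g := fun _ => ((0, [], []) : CState))
    (h := fun _ p => stepC a R p.1 p.2) Computable.id (Computable.const _) ?_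
  exact (computable_stepC ha hR).comp (Computable.fst.comp Computable.snd)
    (Computable.snd.comp Computable.snd)

theorem computable_Bt (ha : Computable a) (hR : Computable₂ R) : Computable (Bt a R) :=
  Computable.fst.comp (computable_stC ha hR)

theorem computable_Ev (ha : Computable a) (hR : Computable₂ R) : Computable (Ev a R) :=
  (computable_evC ha).comp Computable.id (computable_stC ha hR)

theorem computable_Lt (ha : Computable a) (hR : Computable₂ R) (j : ℕ) :
    Computable (fun t => Lt a R t j) :=
  computable_lev.comp (Computable.fst.comp (Computable.snd.comp (computable_stC ha hR)))
    (Computable.const j)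

variable (a R)

/-! ### The recursion equations -/

theorem stC_succ (t : ℕ) : stC a R (t + 1) = stepC a R t (stC a R t) := rfl

theorem Bt_zero : Bt a R 0 = 0 := rfl
theorem Lt_zero (j : ℕ) : Lt a R 0 j = 0 := rfl
theorem Qt_zero (j : ℕ) : Qt a R 0 j = a 0 - 1 := rfl

theorem Bt_succ (t : ℕ) : Bt a R (t + 1) =
    Bt a R t + if Act a R t = true then 2 * (Rt a R t - a t) else 0 := by
  have : Bt a R (t + 1) = bif Act a R t then Bt a R t + 2 * (Rt a R t - a t) else Bt a R t := rfl
  rw [this]; cases Act a R t <;> simp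

theorem Lt_succ (t j : ℕ) : Lt a R (t + 1) j =
    if Ev a R t = true ∧ ix t < j then t else Lt a R t j := by
  have : Lt a R (t + 1) j = lev (bif Ev a R t then (ix t, t) :: (stC a R t).2.1
    else (stC a R t).2.1) j := rfl
  rw [this]; cases Ev a R t <;> simp [Lt, lev]

theorem Qt_succ (t j : ℕ) : Qt a R (t + 1) j =
    if Act a R t = true ∧ ix t = j then Rt a R t else Qt a R t j := by
  have : Qt a R (t + 1) j = lookQ (a 0 - 1) (bif Act a R t then (ix t, Rt a R t) :: (stC a R t).2.2
    else (stC a R t).2.2) j := rfl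
  rw [this]; cases Act a R t <;> simp [Qt, lookQ]

theorem Act_iff (t : ℕ) : Act a R t = true ↔ Qt a R t (ix t) < a t ∧ a t < Rt a R t ∧
    a t - Bt a R t - (Rt a R t - a t) < - psi (ix t) t := by
  have : Act a R t = ((decide (Qt a R t (ix t) < a t) && decide (a t < Rt a R t)) &&
    decide (a t - Bt a R t - (Rt a R t - a t) < 0 - psi (ix t) t)) := rfl
  rw [this]; simp [and_assoc]

theorem Ev_iff (t : ℕ) : Ev a R t = true ↔
    |psi (ix t) t - (a t - Bt a R t)| < (1 / 2) ^ (Lt a R t (ix t + 1)) := by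
  have : Ev a R t = (decide (psi (ix t) t - (a t - Bt a R t) < (1 / 2) ^ (Lt a R t (ix t + 1))) &&
    decide ((a t - Bt a R t) - psi (ix t) t < (1 / 2) ^ (Lt a R t (ix t + 1)))) := rfl
  rw [this, abs_lt, Bool.and_eq_true, decide_eq_true_eq, decide_eq_true_eq]
  constructor <;> rintro ⟨h1, h2⟩ <;> constructor <;> linarith

theorem Lt_le (t j : ℕ) : Lt a R t j ≤ t := by
  induction t with
  | zero => rw [Lt_zero]
  | succ t ih => rw [Lt_succ]; split_ifs <;> omega

theorem Lt_mono (j : ℕ) : Monotone (fun t => Lt a R t j) := by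
  refine monotone_nat_of_le_succ fun t => ?_
  have := Lt_le a R t j
  simp only [Lt_succ]; split_ifs <;> omega

theorem Lt_mono_right (t : ℕ) : Monotone (Lt a R t) := by
  intro i j hij
  induction t with
  | zero => simp [Lt_zero]
  | succ t ih =>
    have := Lt_le a R t i
    simp only [Lt_succ]
    split_ifs with h1 h2 h2
    · omega
    · exact absurd ⟨h1.1, by omega⟩ h2
    · omega
    · exact ih

theorem Qt_src (t j : ℕ) : Qt a R t j = a 0 - 1 ∨
    ∃ s < t, Act a R s = true ∧ ix s = j ∧ Qt a R t j = Rt a R s := by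
  induction t with
  | zero => left; rfl
  | succ t ih =>
    rw [Qt_succ]
    split_ifs with h
    · right; exact ⟨t, by omega, h.1, h.2, rfl⟩
    · rcases ih with h1 | ⟨s, hs, h1⟩
      · left; exact h1
      · right; exact ⟨s, by omega, h1⟩

theorem Bt_mono : Monotone (Bt a R) := by
  refine monotone_nat_of_le_succ fun t => ?_
  rw [Bt_succ]
  split_ifs with h
  · have := ((Act_iff a R t).1 h).2.1
    linarith
  · linarith

/-- Total drop attributed to index `j` at level `m` before stage `t`. -/
def St (t j m : ℕ) : ℚ := ∑ s ∈ Finset.range t,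
  if Act a R s = true ∧ ix s = j ∧ Lt a R s j = m then 2 * (Rt a R s - a s) else 0

theorem St_zero (j m : ℕ) : St a R 0 j m = 0 := rfl
theorem St_succ (t j m : ℕ) : St a R (t + 1) j m = St a R t j m +
    if Act a R t = true ∧ ix t = j ∧ Lt a R t j = m then 2 * (Rt a R t - a t) else 0 :=
  Finset.sum_range_succ _ _

/-- The combinatorial hypothesis. -/
structure NHyp (a : ℕ → ℚ) (α : ℝ) (R C : ℕ → ℕ → ℚ) : Prop where
  acomp : Computable a
  amono : Monotone a
  atend : Tendsto (fun t => (a t : ℝ)) atTop (nhds α)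
  Rcomp : Computable₂ R
  Rmono : ∀ n, Monotone (R n)
  C0 : ∀ n t, 0 ≤ C n t
  Cmono : ∀ n, Monotone (C n)
  Cle : ∀ n t, C n t ≤ (1 / 2) ^ n
  R0 : ∀ n, R n 0 - a 0 ≤ C n 0
  Rstep : ∀ n t, R n (t + 1) ≠ R n t → R n (t + 1) - a (t + 1) ≤ C n (t + 1) - C n t
  Rev : ∀ n, ∃ T, α < R n T

variable {a R}
variable {α : ℝ} {C : ℕ → ℕ → ℚ}

theorem NHyp.dle (h : NHyp a α R C) (n t : ℕ) : R n t - a t ≤ C n t := by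
  induction t with
  | zero => exact h.R0 n
  | succ t ih =>
    have h1 := h.amono (Nat.le_succ t)
    have h2 := h.Cmono n (Nat.le_succ t)
    have h3 := h.C0 n t
    simp only [Nat.succ_eq_add_one] at h1 h2
    by_cases hc : R n (t + 1) = R n t
    · rw [hc]; linarith
    · have := h.Rstep n t hc; linarith

theorem NHyp.time (h : NHyp a α R C) (n t : ℕ) (S q : ℚ) (h1 : S ≤ 2 * C n t)
    (h2 : q < R n t → S + 2 * (R n t - a t) ≤ 2 * C n t) :
    S ≤ 2 * C n (t + 1) ∧
    (q < R n (t + 1) → S + 2 * (R n (t + 1) - a (t + 1)) ≤ 2 * C n (t + 1)) := by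
  have h3 := h.amono (Nat.le_succ t)
  have h4 := h.Cmono n (Nat.le_succ t)
  simp only [Nat.succ_eq_add_one] at h3 h4
  refine ⟨by linarith, fun hq => ?_⟩
  by_cases hc : R n (t + 1) = R n t
  · rw [hc] at hq ⊢
    have := h2 hq
    linarith
  · have := h.Rstep n t hc; linarith

theorem NHyp.inv (h : NHyp a α R C) (t j : ℕ) :
    (St a R t j (Lt a R t j) ≤ 2 * C (Lt a R t j + j) t ∧
    (Qt a R t j < R (Lt a R t j + j) t → St a R t j (Lt a R t j) +
      2 * (R (Lt a R t j + j) t - a t) ≤ 2 * C (Lt a R t j + j) t)) ∧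
    (∀ m, Lt a R t j < m → St a R t j m = 0) ∧ (∀ m, St a R t j m ≤ 2 * (1 / 2) ^ (m + j)) := by
  induction t with
  | zero =>
    simp only [St_zero, Lt_zero, Qt_zero]
    refine ⟨⟨by have := h.C0 (0 + j) 0; linarith, fun _ => ?_⟩, fun _ _ => trivial, fun m => by positivity⟩
    have := h.R0 (0 + j); linarith
  | succ t ih =>
    obtain ⟨⟨i1, i2⟩, i3, i4⟩ := ih
    -- first the act, at the old level
    set m := Lt a R t j with hm
    have key : St a R (t + 1) j m ≤ 2 * C (m + j) t ∧
        (Qt a R (t + 1) j < R (m + j) t → St a R (t + 1) j m +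
        2 * (R (m + j) t - a t) ≤ 2 * C (m + j) t) := by
      rw [St_succ, Qt_succ]
      by_cases hA : Act a R t = true ∧ ix t = j
      · obtain ⟨hA1, hA2⟩ := hA
        rw [if_pos ⟨hA1, hA2, hm.symm⟩, if_pos ⟨hA1, hA2⟩]
        have hRt : Rt a R t = R (m + j) t := by rw [Rt, hA2]
        have hA3 := (Act_iff a R t).1 hA1
        rw [hA2, hRt] at hA3
        rw [hRt]
        have := i2 (hA3.1.trans hA3.2.1)
        exact ⟨by linarith, fun hh => absurd hh (lt_irrefl _)⟩
      · rw [if_neg (fun hh => hA ⟨hh.1, hh.2.1⟩), if_neg hA, add_zero]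
        exact ⟨i1, i2⟩
    have hne : ∀ m', m' ≠ m → St a R (t + 1) j m' = St a R t j m' := by
      intro m' hm'
      rw [St_succ, if_neg (fun hh : _ ∧ _ ∧ _ => hm' (hh.2.2.symm.trans hm.symm)), add_zero]
    have k4 : ∀ m', St a R (t + 1) j m' ≤ 2 * (1 / 2) ^ (m' + j) := by
      intro m'
      by_cases hm' : m' = m
      · rw [hm']
        have := h.Cle (m + j) t
        linarith [key.1]
      · rw [hne m' hm']; exact i4 m'
    have hl : m ≤ Lt a R (t + 1) j := Lt_mono a R j (Nat.le_succ t)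
    refine ⟨?_, fun m' hm' => ?_, k4⟩
    · rcases hl.eq_or_lt with he | hlt
      · rw [← he]
        exact h.time _ _ _ _ key.1 key.2
      · rw [hne _ hlt.ne', i3 _ hlt]
        have h1 := h.C0 (Lt a R (t + 1) j + j) (t + 1)
        have h2 := h.dle (Lt a R (t + 1) j + j) (t + 1)
        exact ⟨by linarith, fun _ => by linarith⟩
    · rw [hne m' (by omega)]
      exact i3 m' (by omega)

theorem geom_tail (l M : ℕ) : ∑ m ∈ Finset.Ico l M, (1 / 2 : ℚ) ^ m ≤ 2 * (1 / 2) ^ l := by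
  by_cases h : l ≤ M
  · have : ∑ m ∈ Finset.Ico l M, (1 / 2 : ℚ) ^ m = 2 * (1 / 2) ^ l - 2 * (1 / 2) ^ M := by
      induction M, h using Nat.le_induction with
      | base => simp
      | succ M hM ih => rw [Finset.sum_Ico_succ_top hM, ih, pow_succ]; ring
    rw [this]
    have : (0 : ℚ) < (1 / 2) ^ M := by positivity
    linarith
  · rw [Finset.Ico_eq_empty (by omega)]; simp

theorem Bt_sub (t u : ℕ) (htu : t ≤ u) : Bt a R u - Bt a R t =
    ∑ s ∈ Finset.Ico t u, if Act a R s = true then 2 * (Rt a R s - a s) else 0 := by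
  induction u, htu using Nat.le_induction with
  | base => simp
  | succ u hu ih => rw [Finset.sum_Ico_succ_top hu, ← ih, Bt_succ]; ring

theorem NHyp.tail (h : NHyp a α R C) (t u l : ℕ) (htu : t ≤ u)
    (hl : ∀ s, t ≤ s → Act a R s = true → l ≤ Lt a R s (ix s)) :
    Bt a R u - Bt a R t ≤ 8 * (1 / 2) ^ l := by
  have hw : ∀ s, 0 ≤ if Act a R s = true then 2 * (Rt a R s - a s) else 0 := fun s => by
    split_ifs with hA
    · have := ((Act_iff a R s).1 hA).2.1; linarith
    · exact le_rfl
  rw [Bt_sub t u htu]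
  have h1 : ∀ s ∈ Finset.Ico t u, (if Act a R s = true then 2 * (Rt a R s - a s) else 0) ≤
      ∑ j ∈ Finset.range (u + 1), ∑ m ∈ Finset.Ico l (u + 1),
        if Act a R s = true ∧ ix s = j ∧ Lt a R s j = m then 2 * (Rt a R s - a s) else 0 := by
    intro s hs
    rw [Finset.mem_Ico] at hs
    have hnn : ∀ j m, 0 ≤ if Act a R s = true ∧ ix s = j ∧ Lt a R s j = m then
        2 * (Rt a R s - a s) else 0 := by
      intro j m
      split_ifs with hA
      · have := ((Act_iff a R s).1 hA.1).2.1; linarith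
      · exact le_rfl
    by_cases hA : Act a R s = true
    · have hj : ix s ∈ Finset.range (u + 1) := by
        have : ix s ≤ s := Nat.unpair_left_le s
        rw [Finset.mem_range]; omega
      have hm : Lt a R s (ix s) ∈ Finset.Ico l (u + 1) := by
        have h1 := hl s hs.1 hA
        have h2 := Lt_le a R s (ix s)
        rw [Finset.mem_Ico]; omega
      refine le_trans ?_ (Finset.single_le_sum (f := fun j => ∑ m ∈ Finset.Ico l (u + 1),
        if Act a R s = true ∧ ix s = j ∧ Lt a R s j = m then 2 * (Rt a R s - a s) else 0)
        (fun j _ => Finset.sum_nonneg fun m _ => hnn j m) hj)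
      refine le_trans ?_ (Finset.single_le_sum (f := fun m => 
        if Act a R s = true ∧ ix s = ix s ∧ Lt a R s (ix s) = m then 2 * (Rt a R s - a s) else 0)
        (fun m _ => hnn (ix s) m) hm)
      simp [hA]
    · rw [if_neg hA]
      exact Finset.sum_nonneg fun j _ => Finset.sum_nonneg fun m _ => hnn j m
  refine (Finset.sum_le_sum h1).trans ?_
  rw [Finset.sum_comm]
  have h2 : ∀ j ∈ Finset.range (u + 1), ∑ s ∈ Finset.Ico t u, ∑ m ∈ Finset.Ico l (u + 1),
        (if Act a R s = true ∧ ix s = j ∧ Lt a R s j = m then 2 * (Rt a R s - a s) else 0)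
        ≤ 4 * (1 / 2) ^ l * (1 / 2) ^ j := by
    intro j _
    rw [Finset.sum_comm]
    have h3 : ∀ m ∈ Finset.Ico l (u + 1), ∑ s ∈ Finset.Ico t u,
        (if Act a R s = true ∧ ix s = j ∧ Lt a R s j = m then 2 * (Rt a R s - a s) else 0)
        ≤ 2 * (1 / 2) ^ j * (1 / 2) ^ m := by
      intro m _
      have h4 : ∑ s ∈ Finset.Ico t u,
        (if Act a R s = true ∧ ix s = j ∧ Lt a R s j = m then 2 * (Rt a R s - a s) else 0)
        ≤ St a R u j m := by
        refine Finset.sum_le_sum_of_subset_of_nonneg ?_ ?_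
        · intro s hs; simp at hs ⊢; omega
        · intro s _ _
          split_ifs with hA
          · have := ((Act_iff a R s).1 hA.1).2.1; linarith
          · exact le_rfl
      have h5 := (h.inv u j).2.2 m
      rw [pow_add] at h5
      linarith
    refine (Finset.sum_le_sum h3).trans ?_
    rw [← Finset.mul_sum]
    have h6 := geom_tail l (u + 1)
    have h7 : (0 : ℚ) ≤ 2 * (1 / 2) ^ j := by positivity
    have := mul_le_mul_of_nonneg_left h6 h7
    linarith
  refine (Finset.sum_le_sum h2).trans ?_
  rw [← Finset.mul_sum]
  have h6 := geom_tail 0 (u + 1)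
  rw [← Finset.range_eq_Ico, pow_zero] at h6
  have h7 : (0 : ℚ) ≤ 4 * (1 / 2) ^ l := by positivity
  have := mul_le_mul_of_nonneg_left h6 h7
  linarith

end Construction

/-! ## Verification of the construction -/

section Verification

variable {a : ℕ → ℚ} {R C : ℕ → ℕ → ℚ} {α : ℝ}

theorem NHyp.a_le (h : NHyp a α R C) (t : ℕ) : (a t : ℝ) ≤ α := by
  have hm : Monotone (fun t => (a t : ℝ)) := fun s t hst => Rat.cast_le.2 (h.amono hst)
  exact hm.ge_of_tendsto h.atend t

theorem NHyp.exists_lim (h : NHyp a α R C) :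
    ∃ β : ℝ, Tendsto (fun t => (Bt a R t : ℝ)) atTop (nhds β) ∧ ∀ t, (Bt a R t : ℝ) ≤ β := by
  have hm : Monotone (fun t => (Bt a R t : ℝ)) := fun s t hst => Rat.cast_le.2 (Bt_mono a R hst)
  have hb : BddAbove (Set.range fun t => (Bt a R t : ℝ)) := by
    refine ⟨8, ?_⟩
    rintro _ ⟨t, rfl⟩
    have := h.tail 0 t 0 (Nat.zero_le _) (fun _ _ _ => Nat.zero_le _)
    rw [Bt_zero, pow_zero, sub_zero, mul_one] at this
    have h2 : (Bt a R t : ℝ) ≤ ((8 : ℚ) : ℝ) := Rat.cast_le.2 this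
    simpa using h2
  have ht := tendsto_atTop_ciSup hm hb
  exact ⟨_, ht, fun t => hm.ge_of_tendsto ht t⟩

theorem Lt_stable {e T : ℕ} (hT : ∀ t ≥ T, ix t < e → Ev a R t = false) (t : ℕ) (ht : T ≤ t) :
    Lt a R t e = Lt a R T e := by
  induction t, ht using Nat.le_induction with
  | base => rfl
  | succ t ht ih =>
    rw [Lt_succ, if_neg, ih]
    rintro ⟨h1, h2⟩
    rw [hT t ht h2] at h1
    exact absurd h1 (by simp)

theorem Qt_stable {e T : ℕ} (hT : ∀ t ≥ T, ix t = e → Act a R t = false) (t : ℕ) (ht : T ≤ t) :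
    Qt a R t e = Qt a R T e := by
  induction t, ht using Nat.le_induction with
  | base => rfl
  | succ t ht ih =>
    rw [Qt_succ, if_neg, ih]
    rintro ⟨h1, h2⟩
    rw [hT t ht h2] at h1
    exact absurd h1 (by simp)

theorem NHyp.act_finite (h : NHyp a α R C) {e T : ℕ}
    (hT : ∀ t ≥ T, ix t < e → Ev a R t = false) :
    ∃ T', ∀ t ≥ T', ix t = e → Act a R t = false := by
  obtain ⟨β, hβ, hle⟩ := h.exists_lim
  obtain ⟨T1, hT1⟩ := h.Rev (Lt a R T e + e)
  set q := R (Lt a R T e + e) T1 with hq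
  have hpos : 0 < 2 * ((q : ℝ) - α) := by linarith
  have hev := (tendsto_order.1 hβ).1 (β - 2 * (q - α)) (by linarith)
  obtain ⟨T2, hT2⟩ := eventually_atTop.1 hev
  refine ⟨max T (max T1 T2), fun t ht hix => ?_⟩
  have ht0 : T ≤ t := (le_max_left _ _).trans ht
  have ht1 : T1 ≤ t := ((le_max_left _ _).trans (le_max_right _ _)).trans ht
  have ht2 : T2 ≤ t := ((le_max_right _ _).trans (le_max_right _ _)).trans ht
  by_contra hA
  have hA : Act a R t = true := by simpa using hA
  have h1 := Bt_succ a R t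
  rw [if_pos hA, Rt, hix, Lt_stable hT t ht0] at h1
  have h2 : q ≤ R (Lt a R T e + e) t := h.Rmono _ ht1
  have h3 : ((Bt a R (t + 1) : ℚ) : ℝ) = Bt a R t + 2 * (R (Lt a R T e + e) t - a t) := by
    rw [h1]; push_cast; ring
  have h4 : (q : ℝ) ≤ R (Lt a R T e + e) t := Rat.cast_le.2 h2
  have h5 := h.a_le t
  have h6 := hT2 t ht2
  have h7 := hle (t + 1)
  linarith

theorem half_lt {ε : ℝ} (hε : 0 < ε) : ∃ n : ℕ, ∀ m, n ≤ m → ((1 / 2 : ℝ)) ^ m < ε := by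
  obtain ⟨n, hn⟩ := exists_pow_lt_of_lt_one hε (show (1 / 2 : ℝ) < 1 by norm_num)
  exact ⟨n, fun m hm => (pow_le_pow_of_le_one (by norm_num) (by norm_num) hm).trans_lt hn⟩

theorem Ev_real (t : ℕ) (hE : Ev a R t = true) :
    |(psi (ix t) t : ℝ) - (a t - Bt a R t)| < (1 / 2) ^ (Lt a R t (ix t + 1)) := by
  have h1 := (Ev_iff a R t).1 hE
  have h2 : ((|psi (ix t) t - (a t - Bt a R t)| : ℚ) : ℝ) <
    (((1 / 2) ^ (Lt a R t (ix t + 1)) : ℚ) : ℝ) := Rat.cast_lt.2 h1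
  push_cast at h2
  exact h2

theorem NHyp.ev_finite (h : NHyp a α R C) (hnc : ¬ ComputableReal α) {e T : ℕ}
    (hT : ∀ t ≥ T, ix t < e → Ev a R t = false)
    (hT' : ∀ t ≥ T, ix t ≤ e → Act a R t = false) :
    ∃ T', ∀ t ≥ T', ix t = e → Ev a R t = false := by
  by_contra hcon
  push Not at hcon
  have hinf : ∀ T', ∃ t ≥ T', ix t = e ∧ Ev a R t = true := by
    intro T'
    obtain ⟨t, h1, h2, h3⟩ := hcon T'
    exact ⟨t, h1, h2, by simpa using h3⟩
  obtain ⟨β, hβ, hle⟩ := h.exists_lim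
  -- events with high level
  have hhigh : ∀ n T', ∃ t ≥ T', ix t = e ∧ Ev a R t = true ∧ n ≤ Lt a R t (e + 1) := by
    intro n T'
    obtain ⟨t0, h1, h2, h3⟩ := hinf n
    obtain ⟨t1, g1, g2, g3⟩ := hinf (max T' (t0 + 1))
    refine ⟨t1, (le_max_left _ _).trans g1, g2, g3, ?_⟩
    have := Lt_mono a R (e + 1) ((le_max_right _ _).trans g1)
    simp only [Lt_succ] at this
    rw [if_pos ⟨h3, by omega⟩] at this
    omega
  have hγ : Tendsto (fun t => (a t : ℝ) - Bt a R t) atTop (nhds (α - β)) := h.atend.sub hβ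
  have hpsi : ∀ t, α - β ≤ psi e t := by
    intro t
    refine le_of_forall_pos_lt_add fun ε hε => ?_
    obtain ⟨n, hn⟩ := half_lt (half_pos hε)
    obtain ⟨T2, hT2⟩ := eventually_atTop.1 ((tendsto_order.1 hγ).1 (α - β - ε / 2) (by linarith))
    obtain ⟨s, h1, h2, h3, h4⟩ := hhigh n (max t T2)
    have h5 := Ev_real s h3
    rw [h2] at h5
    have h6 := hn _ h4
    have h7 := hT2 s ((le_max_right _ _).trans h1)
    have h8 : (psi e s : ℝ) ≤ psi e t := Rat.cast_le.2 (psi_antitone e ((le_max_left _ _).trans h1))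
    have h9 := (abs_lt.1 h5).1
    linarith
  obtain ⟨K, hK⟩ := exists_nat_gt α
  apply hnc
  refine computable_of_upper (a := a) (u := fun t => if T ≤ t ∧ ix t = e ∧ Ev a R t = true then
    a t + 9 * (1 / 2) ^ (Lt a R t (e + 1)) else (K : ℚ)) h.acomp ?_ h.a_le ?_ ?_
  · refine comp_ite ?_ (qadd h.acomp (qmul (Computable.const 9) (qpow _ 
      (computable_Lt h.acomp h.Rcomp (e + 1))))) (Computable.const _)
    have h1 : Computable (fun t => (decide (T < t + 1) && (decide (ix t = e) && Ev a R t))) := 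
      Primrec.and.to_comp.comp (nltd (Computable.const T) Computable.succ)
        (Primrec.and.to_comp.comp (neqd computable_ix (Computable.const e)) 
          (computable_Ev h.acomp h.Rcomp))
    refine h1.of_eq fun t => ?_
    rw [Bool.eq_iff_iff]
    simp [Nat.lt_succ_iff]
  · intro t
    split_ifs with hc
    · obtain ⟨h1, h2, h3⟩ := hc
      have h4 := Ev_real t h3
      rw [h2] at h4
      have h5 : ∀ u ≥ t, Bt a R u - Bt a R t ≤ 8 * (1 / 2) ^ (Lt a R t (e + 1)) := by
        intro u hu
        refine h.tail t u _ hu fun s hs hA => ?_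
        have : e < ix s := by
          by_contra hc
          rw [hT' s (h1.trans hs) (by omega)] at hA
          exact absurd hA (by simp)
        exact (Lt_mono a R (e + 1) hs).trans (Lt_mono_right a R s this)
      have h6 : β ≤ Bt a R t + 8 * (1 / 2) ^ (Lt a R t (e + 1)) := by
        refine le_of_tendsto hβ ?_
        filter_upwards [eventually_ge_atTop t] with u hu
        have h7 : ((Bt a R u - Bt a R t : ℚ) : ℝ) ≤ ((8 * (1 / 2) ^ (Lt a R t (e + 1)) : ℚ) : ℝ) :=
          Rat.cast_le.2 (h5 u hu)
        push_cast at h7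
        linarith
      have h8 := hpsi t
      have h9 := (abs_lt.1 h4).2
      push_cast
      linarith
    · push_cast; exact hK.le
  · intro ε hε
    have hε' : (0 : ℝ) < (ε : ℝ) / 9 := by
      have : (0 : ℝ) < ε := Rat.cast_pos.2 hε
      positivity
    obtain ⟨n, hn⟩ := half_lt hε'
    obtain ⟨s, h1, h2, h3, h4⟩ := hhigh n T
    refine ⟨s, ?_⟩
    rw [if_pos ⟨h1, h2, h3⟩]
    have h5 := hn _ h4
    have h6 : ((9 * (1 / 2) ^ (Lt a R s (e + 1)) : ℚ) : ℝ) < ε := by push_cast; linarith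
    have h7 := Rat.cast_lt.1 h6
    linarith

theorem NHyp.settled (h : NHyp a α R C) (hnc : ¬ ComputableReal α) (e : ℕ) :
    ∃ T, ∀ t ≥ T, ix t < e → Act a R t = false ∧ Ev a R t = false := by
  induction e with
  | zero => exact ⟨0, fun t _ h => absurd h (by omega)⟩
  | succ e ih =>
    obtain ⟨T, hT⟩ := ih
    obtain ⟨T1, hT1⟩ := h.act_finite (fun t ht hix => (hT t ht hix).2)
    obtain ⟨T2, hT2⟩ := h.ev_finite hnc (e := e) (T := max T T1)
      (fun t ht hix => (hT t ((le_max_left _ _).trans ht) hix).2)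
      (fun t ht hix => by
        rcases hix.lt_or_eq with h1 | h1
        · exact (hT t ((le_max_left _ _).trans ht) h1).1
        · exact hT1 t ((le_max_right _ _).trans ht) h1)
    refine ⟨max T (max T1 T2), fun t ht hix => ?_⟩
    have ht0 : T ≤ t := (le_max_left _ _).trans ht
    have ht1 : T1 ≤ t := ((le_max_left _ _).trans (le_max_right _ _)).trans ht
    have ht2 : T2 ≤ t := ((le_max_right _ _).trans (le_max_right _ _)).trans ht
    rcases (Nat.lt_succ_iff.1 hix).lt_or_eq with h1 | h1
    · exact hT t ht0 h1
    · exact ⟨hT1 t ht1 h1, hT2 t ht2 h1⟩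

theorem ix_pair (e x : ℕ) : ix (Nat.pair e x) = e := by simp [ix]

theorem NHyp.main (h : NHyp a α R C) (hnc : ¬ ComputableReal α) :
    ∃ β : ℝ, ∃ b : ℕ → ℚ, Computable b ∧ Monotone b ∧ 
      Tendsto (fun t => (b t : ℝ)) atTop (nhds β) ∧ ¬ LeftCE (α - β) ∧ ¬ RightCE (α - β) := by
  obtain ⟨β, hβ, hle⟩ := h.exists_lim
  have hγ : Tendsto (fun t => (a t : ℝ) - Bt a R t) atTop (nhds (α - β)) := h.atend.sub hβ
  refine ⟨β, Bt a R, computable_Bt h.acomp h.Rcomp, Bt_mono a R, hβ, ?_, ?_⟩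
  · rintro ⟨f, hf, hfm, hft⟩
    have hft' : Tendsto (fun n => ((0 - f n : ℚ) : ℝ)) atTop (nhds (-(α - β))) := by
      refine hft.neg.congr fun n => ?_
      push_cast; ring
    obtain ⟨e, he1, he2⟩ := psi_spec (f := fun n => 0 - f n) (qsub (Computable.const 0) hf)
      (fun x y hxy => by have := hfm.monotone hxy; simp only; linarith) hft'
    obtain ⟨T, hT⟩ := h.settled hnc (e + 1)
    have hLs : ∀ t ≥ T, Lt a R t e = Lt a R T e := Lt_stable fun t ht hix => 
      (hT t ht (by omega)).2
    have hQs : ∀ t ≥ T, Qt a R t e = Qt a R T e := Qt_stable fun t ht hix => 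
      (hT t ht (by omega)).1
    rcases le_or_gt α (Qt a R T e) with hQ | hQ
    · rcases Qt_src a R T e with h1 | ⟨s, _, h2, h3, h4⟩
      · have h5 := h.a_le 0
        rw [h1] at hQ
        push_cast at hQ
        linarith
      · rw [h4] at hQ
        have h5 := ((Act_iff a R s).1 h2).2.2
        rw [h3] at h5
        have h6 : ((a s - Bt a R s - (Rt a R s - a s) : ℚ) : ℝ) < ((- psi e s : ℚ) : ℝ) :=
          Rat.cast_lt.2 h5
        push_cast at h6
        have h7 := Bt_succ a R s
        rw [if_pos h2] at h7
        have h8 : ((Bt a R (s + 1) : ℚ) : ℝ) = Bt a R s + 2 * (Rt a R s - a s) := by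
          rw [h7]; push_cast; ring
        have h9 := hle (s + 1)
        have h10 := he1 s
        linarith
    · obtain ⟨T1, hT1⟩ := h.Rev (Lt a R T e + e)
      set q := R (Lt a R T e + e) T1 with hq
      obtain ⟨T2, hT2⟩ := eventually_atTop.1 ((tendsto_order.1 h.atend).1 _ hQ)
      have hlim : Tendsto (fun t => ((a t : ℝ) - Bt a R t) + psi e t) atTop (nhds 0) := by
        have := hγ.add he2
        simpa using this
      obtain ⟨T3, hT3⟩ := eventually_atTop.1 ((tendsto_order.1 hlim).2 (q - α) (by linarith))
      set M := max T (max T1 (max T2 T3)) with hM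
      set t := Nat.pair e M with ht
      have htM : M ≤ t := Nat.right_le_pair e M
      have hix : ix t = e := ix_pair e M
      have ht0 : T ≤ t := by omega
      have ht1 : T1 ≤ t := by omega
      have ht2 : T2 ≤ t := by omega
      have ht3 : T3 ≤ t := by omega
      have hna := (hT t ht0 (by omega)).1
      have hRt : Rt a R t = R (Lt a R T e + e) t := by rw [Rt, hix, hLs t ht0]
      have hqR : (q : ℝ) ≤ Rt a R t := by rw [hRt]; exact Rat.cast_le.2 (h.Rmono _ ht1)
      have hac : Act a R t = true := by
        rw [Act_iff, hix, hQs t ht0]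
        refine ⟨Rat.cast_lt.1 (hT2 t ht2), ?_, ?_⟩
        · have : (a t : ℝ) < Rt a R t := by linarith [h.a_le t]
          exact Rat.cast_lt.1 this
        · have h1 := hT3 t ht3
          have h2 : ((a t - Bt a R t - (Rt a R t - a t) : ℚ) : ℝ) < ((- psi e t : ℚ) : ℝ) := by
            push_cast
            linarith [h.a_le t]
          exact Rat.cast_lt.1 h2
      rw [hna] at hac
      exact absurd hac (by simp)
  · rintro ⟨f, hf, hfm, hft⟩
    obtain ⟨e, he1, he2⟩ := psi_spec hf hfm.antitone hft
    obtain ⟨T, hT⟩ := h.settled hnc (e + 1)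
    have hLs : ∀ t ≥ T, Lt a R t (e + 1) = Lt a R T (e + 1) := Lt_stable fun t ht hix => 
      (hT t ht hix).2
    have hlim : Tendsto (fun t => |(psi e t : ℝ) - (a t - Bt a R t)|) atTop (nhds 0) := by
      have := (he2.sub hγ).abs
      simpa using this
    obtain ⟨T3, hT3⟩ := eventually_atTop.1 ((tendsto_order.1 hlim).2 
      ((1 / 2) ^ (Lt a R T (e + 1))) (by positivity))
    set t := Nat.pair e (max T T3) with ht
    have htM : max T T3 ≤ t := Nat.right_le_pair e _
    have hix : ix t = e := ix_pair e _
    have hne := (hT t (by omega) (by omega)).2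
    have hac : Ev a R t = true := by
      rw [Ev_iff, hix, hLs t (by omega)]
      have h1 := hT3 t (by omega)
      have h2 : ((|psi e t - (a t - Bt a R t)| : ℚ) : ℝ) < (((1 / 2) ^ (Lt a R T (e + 1)) : ℚ) : ℝ) := by
        push_cast; exact h1
      exact Rat.cast_lt.1 h2
    rw [hne] at hac
    exact absurd hac (by simp)

end Verification

/-! ## The halting real -/

section Halting
open Nat.Partrec (Code)
open Encodable

theorem qsum {A : Type*} [Primcodable A] {f : A → ℕ} {g : A → ℕ → ℚ} (hf : Computable f)
    (hg : Computable₂ g) : Computable fun a => ∑ i ∈ Finset.range (f a), g a i := by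
  have : Computable fun a => (Nat.rec (0 : ℚ) (fun i ih => ih + g a i) (f a) : ℚ) :=
    Computable.nat_rec (h := fun a p => p.2 + g a p.1) hf (Computable.const 0)
      (qadd (Computable.snd.comp Computable.snd)
        (hg.comp Computable.fst (Computable.fst.comp Computable.snd)))
  refine this.of_eq fun a => ?_
  induction f a with
  | zero => simp
  | succ n ih => rw [Finset.sum_range_succ, ← ih]

def chi (t i : ℕ) : ℕ :=
  if (decide (i < t) && (Code.evaln t (Denumerable.ofNat Code i) 0).isSome) = true then 1 else 0

theorem computable_chi : Computable₂ chi := by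
  refine Computable.of_eq (f := fun p : ℕ × ℕ => bif (decide (p.2 < p.1) && 
    (Code.evaln p.1 (Denumerable.ofNat Code p.2) 0).isSome) then 1 else 0) ?_ ?_
  · refine Computable.cond (Primrec.and.to_comp.comp (nltd Computable.snd Computable.fst) ?_)
      (Computable.const 1) (Computable.const 0)
    exact (Primrec.option_isSome.comp (Code.primrec_evaln.comp (Primrec.pair (Primrec.pair
      Primrec.fst ((Primrec.ofNat Code).comp Primrec.snd)) (Primrec.const 0)))).to_comp
  · intro p
    simp only [chi]
    cases (decide (p.2 < p.1) && (Code.evaln p.1 (Denumerable.ofNat Code p.2) 0).isSome) <;> rfl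

theorem chi_le_one (t i : ℕ) : chi t i ≤ 1 := by unfold chi; split_ifs <;> omega

theorem chi_eq_zero {t i : ℕ} (h : t ≤ i) : chi t i = 0 := by
  unfold chi
  rw [if_neg]
  simp
  omega

theorem chi_mono (i : ℕ) : Monotone (fun t => chi t i) := by
  intro s t hst
  simp only [chi]
  split_ifs with h1 h2
  · exact le_rfl
  · exfalso
    apply h2
    rw [Bool.and_eq_true, decide_eq_true_eq, Option.isSome_iff_exists] at h1 ⊢
    obtain ⟨h3, v, hv⟩ := h1
    exact ⟨by omega, v, Code.evaln_mono hst hv⟩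
  · omega
  · omega

theorem chi_iff (i : ℕ) : (∃ t, chi t i = 1) ↔ ((Denumerable.ofNat Code i).eval 0).Dom := by
  constructor
  · rintro ⟨t, ht⟩
    unfold chi at ht
    split_ifs at ht with h
    rw [Bool.and_eq_true, Option.isSome_iff_exists] at h
    obtain ⟨_, v, hv⟩ := h
    exact Part.dom_iff_mem.2 ⟨v, Code.evaln_sound hv⟩
  · intro h
    obtain ⟨v, hv⟩ := Part.dom_iff_mem.1 h
    obtain ⟨k, hk⟩ := Code.evaln_complete.1 hv
    refine ⟨max k (i + 1), ?_⟩
    unfold chi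
    rw [if_pos]
    rw [Bool.and_eq_true, decide_eq_true_eq, Option.isSome_iff_exists]
    exact ⟨by omega, v, Code.evaln_mono (le_max_left _ _) hk⟩

theorem not_computable_chi (g : ℕ → ℕ) (hg : Computable g)
    (h : ∀ i, (∃ t, chi t i = 1) ↔ chi (g i) i = 1) : False := by
  apply ComputablePred.halting_problem 0
  have hc : Computable (fun c : Code => decide (chi (g (encode c)) (encode c) = 1)) :=
    neqd (computable_chi.comp (hg.comp Computable.encode) Computable.encode) (Computable.const 1)
  have he : ∀ c : Code, chi (g (encode c)) (encode c) = 1 ↔ (c.eval 0).Dom := fun c => by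
    rw [← h, chi_iff, Denumerable.ofNat_encode]
  refine ⟨fun c => decidable_of_iff _ (he c), hc.of_eq fun c => ?_⟩
  exact decide_eq_decide.2 (he c)

/-- Partial sums of the halting real. -/
def ksum (m t : ℕ) : ℚ := ∑ i ∈ Finset.range m, (chi t i : ℚ) * (1 / 4) ^ i

def kreal (t : ℕ) : ℚ := ksum t t

theorem computable_ksum : Computable₂ ksum := by
  refine qsum (f := fun p : ℕ × ℕ => p.1) (g := fun p i => (chi p.2 i : ℚ) * (1 / 4) ^ i)
    Computable.fst ?_
  exact qmul (qcast (computable_chi.comp (Computable.snd.comp Computable.fst) Computable.snd))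
    (qpow _ Computable.snd)

theorem computable_kreal : Computable kreal := computable_ksum.comp Computable.id Computable.id

theorem ksum_mono (m : ℕ) : Monotone (ksum m) := by
  intro s t hst
  refine Finset.sum_le_sum fun i _ => ?_
  have : (chi s i : ℚ) ≤ chi t i := Nat.cast_le.2 (chi_mono i hst)
  gcongr

theorem ksum_eq {t m : ℕ} (h : t ≤ m) : ksum m t = kreal t := by
  unfold kreal ksum
  symm
  refine Finset.sum_subset (Finset.range_mono h) fun i _ hi => ?_
  rw [chi_eq_zero (by simpa using hi)]
  simp

theorem ksum_le (m t : ℕ) : ksum m t ≤ kreal t := by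
  rw [← ksum_eq (le_max_right m t)]
  refine Finset.sum_le_sum_of_subset_of_nonneg (Finset.range_mono (le_max_left _ _)) fun i _ _ => ?_
  positivity

theorem kreal_mono : Monotone kreal := by
  intro s t hst
  rw [← ksum_eq hst]
  exact ksum_mono t hst

theorem kreal_nonneg (t : ℕ) : 0 ≤ kreal t := by
  unfold kreal ksum
  exact Finset.sum_nonneg fun i _ => by positivity

theorem geom4 (m M : ℕ) (h : m ≤ M) :
    ∑ i ∈ Finset.Ico m M, (1 / 4 : ℚ) ^ i ≤ 4 / 3 * (1 / 4) ^ m := by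
  have : ∑ i ∈ Finset.Ico m M, (1 / 4 : ℚ) ^ i = 4 / 3 * (1 / 4) ^ m - 4 / 3 * (1 / 4) ^ M := by
    induction M, h using Nat.le_induction with
    | base => simp
    | succ M hM ih => rw [Finset.sum_Ico_succ_top hM, ih, pow_succ]; ring
  rw [this]
  have : (0 : ℚ) < (1 / 4) ^ M := by positivity
  linarith

theorem kreal_le (m t : ℕ) : kreal t ≤ ksum m t + 4 / 3 * (1 / 4) ^ m := by
  rw [← ksum_eq (le_max_right m t)]
  have h1 := geom4 m (max m t) (le_max_left _ _)
  have h2 : ksum (max m t) t = ksum m t + ∑ i ∈ Finset.Ico m (max m t), (chi t i : ℚ) * (1 / 4) ^ i :=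
    (Finset.sum_range_add_sum_Ico _ (le_max_left _ _)).symm
  rw [h2]
  have h3 : ∑ i ∈ Finset.Ico m (max m t), (chi t i : ℚ) * (1 / 4) ^ i ≤
      ∑ i ∈ Finset.Ico m (max m t), (1 / 4 : ℚ) ^ i := by
    refine Finset.sum_le_sum fun i _ => ?_
    have : (chi t i : ℚ) ≤ 1 := by exact_mod_cast chi_le_one t i
    have h4 : (0 : ℚ) < (1 / 4) ^ i := by positivity
    nlinarith
  linarith

theorem kreal_le_two (t : ℕ) : kreal t ≤ 2 := by
  have := kreal_le 0 t
  simp [ksum] at this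
  linarith

theorem kreal_add {s i : ℕ} (h0 : chi s i = 0) {t : ℕ} (ht : chi t i = 1) :
    ∃ u, kreal s + (1 / 4) ^ i ≤ kreal u := by
  refine ⟨max s t, ?_⟩
  have h1 : chi (max s t) i = 1 := by
    have h2 : chi t i ≤ chi (max s t) i := chi_mono i (le_max_right s t)
    have := chi_le_one (max s t) i
    omega
  rw [← ksum_eq (le_max_left s t)]
  have hi : i ∈ Finset.range (max s t) := by
    rw [Finset.mem_range]
    by_contra hc
    rw [chi_eq_zero (by omega)] at h1
    omega
  have h3 : ∑ j ∈ Finset.range (max s t), ((chi (max s t) j : ℚ) - chi s j) * (1 / 4) ^ j ≥ (1 / 4) ^ i := by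
    have := Finset.single_le_sum (f := fun j => ((chi (max s t) j : ℚ) - chi s j) * (1 / 4) ^ j)
      (fun j _ => by
        have : (chi s j : ℚ) ≤ chi (max s t) j := Nat.cast_le.2 (chi_mono j (le_max_left s t))
        have : 0 ≤ (chi (max s t) j : ℚ) - chi s j := by linarith
        positivity) hi
    simpa [h1, h0] using this
  have h4 : ∑ j ∈ Finset.range (max s t), ((chi (max s t) j : ℚ) - chi s j) * (1 / 4) ^ j =
      kreal (max s t) - ksum (max s t) s := by
    simp only [kreal, ksum, sub_mul, Finset.sum_sub_distrib]
  linarith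

theorem exists_kreal_lim : ∃ A : ℝ, Tendsto (fun t => (kreal t : ℝ)) atTop (nhds A) ∧
    ∀ t, (kreal t : ℝ) ≤ A := by
  have hm : Monotone (fun t => (kreal t : ℝ)) := fun s t hst => Rat.cast_le.2 (kreal_mono hst)
  have hb : BddAbove (Set.range fun t => (kreal t : ℝ)) := by
    refine ⟨2, ?_⟩
    rintro _ ⟨t, rfl⟩
    have h2 : (kreal t : ℝ) ≤ ((2 : ℚ) : ℝ) := Rat.cast_le.2 (kreal_le_two t)
    simpa using h2
  have ht := tendsto_atTop_ciSup hm hb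
  exact ⟨_, ht, fun t => hm.ge_of_tendsto ht t⟩

theorem kreal_noncomputable {A : ℝ} (hA : Tendsto (fun t => (kreal t : ℝ)) atTop (nhds A))
    (hle : ∀ t, (kreal t : ℝ) ≤ A) (c : ℚ) (hc : 0 < c) : ¬ ComputableReal (c * A) := by
  rintro ⟨f, hf, hfA⟩
  have hc' : (0 : ℝ) < c := Rat.cast_pos.2 hc
  have hfA' : ∀ n, |(f n : ℝ) - c * A| < (((1 / 2) ^ n : ℚ) : ℝ) := fun n => by
    have := hfA n
    push_cast
    simpa using this
  -- the search
  have hex : ∀ i, ∃ p : ℕ, (decide (chi p i = 1) || 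
      decide (f p + (1 / 2) ^ p < c * kreal p + c * (1 / 4) ^ i)) = true := by
    intro i
    have h1 : Tendsto (fun p => (c * kreal p : ℝ) - (f p + (((1 / 2) ^ p : ℚ) : ℝ))) atTop
        (nhds (c * A - (c * A + 0))) := by
      refine (hA.const_mul _).sub (Tendsto.add ?_ tendsto_half)
      rw [tendsto_iff_norm_sub_tendsto_zero]
      refine squeeze_zero (fun _ => norm_nonneg _) (fun n => (hfA' n).le) tendsto_half
    have h2 : (0 : ℝ) < c * (1 / 4) ^ i := by positivity
    obtain ⟨p, hp⟩ := ((tendsto_order.1 h1).1 (-(c * (1 / 4) ^ i)) (by linarith)).exists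
    refine ⟨p, ?_⟩
    rw [Bool.or_eq_true, decide_eq_true_eq, decide_eq_true_eq]
    right
    have h3 : ((f p + (1 / 2) ^ p : ℚ) : ℝ) < ((c * kreal p + c * (1 / 4) ^ i : ℚ) : ℝ) := by
      push_cast at hp ⊢
      linarith
    exact Rat.cast_lt.1 h3
  have hcomp : Computable₂ (fun i p : ℕ => (decide (chi p i = 1) || 
      decide (f p + (1 / 2) ^ p < c * kreal p + c * (1 / 4) ^ i))) := by
    refine Primrec.or.to_comp.comp (neqd (computable_chi.comp Computable.snd Computable.fst) 
      (Computable.const 1)) (qltd (qadd (hf.comp Computable.snd) (qpow _ Computable.snd)) ?_)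
    exact qadd (qmul (Computable.const c) (computable_kreal.comp Computable.snd)) 
      (qmul (Computable.const c) (qpow _ Computable.fst))
  obtain ⟨g, hg, hgs⟩ := exists_search hcomp hex
  refine not_computable_chi g hg fun i => ⟨fun ⟨t, ht⟩ => ?_, fun h => ⟨_, h⟩⟩
  by_contra hne
  have h1 := hgs i
  rw [Bool.or_eq_true, decide_eq_true_eq, decide_eq_true_eq] at h1
  rcases h1 with h1 | h1
  · exact hne h1
  · have h0 : chi (g i) i = 0 := by have := chi_le_one (g i) i; omega
    obtain ⟨u, hu⟩ := kreal_add h0 ht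
    have h2 : ((kreal (g i) + (1 / 4) ^ i : ℚ) : ℝ) ≤ A := (Rat.cast_le.2 hu).trans (hle u)
    have h3 : ((f (g i) + (1 / 2) ^ (g i) : ℚ) : ℝ) < ((c * kreal (g i) + c * (1 / 4) ^ i : ℚ) : ℝ) :=
      Rat.cast_lt.2 h1
    have h4 := (abs_lt.1 (hfA' (g i))).1
    have h5 := mul_le_mul_of_nonneg_left h2 hc'.le
    push_cast at h3 h4 h5
    linarith

def kcnt (m t : ℕ) : ℕ := ∑ i ∈ Finset.range m, chi t i

theorem kcnt_mono (m : ℕ) : Monotone (kcnt m) := fun _ _ hst =>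
  Finset.sum_le_sum fun i _ => chi_mono i hst

theorem kcnt_le (m t : ℕ) : kcnt m t ≤ m := by
  have : kcnt m t ≤ ∑ i ∈ Finset.range m, 1 := Finset.sum_le_sum fun i _ => chi_le_one t i
  simpa using this

theorem kcnt_step {m t : ℕ} (h : ksum m (t + 1) ≠ ksum m t) : kcnt m t + 1 ≤ kcnt m (t + 1) := by
  have : ∃ i ∈ Finset.range m, chi (t + 1) i ≠ chi t i := by
    by_contra hc
    push Not at hc
    exact h (Finset.sum_congr rfl fun i hi => by rw [hc i hi])
  obtain ⟨i, hi, hne⟩ := this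
  refine Finset.sum_lt_sum (fun j _ => chi_mono j (Nat.le_succ t)) ⟨i, hi, ?_⟩
  have h2 : chi t i ≤ chi (t + 1) i := chi_mono i (Nat.le_succ t)
  exact lt_of_le_of_ne h2 (Ne.symm hne)

theorem kreal_NHyp {A : ℝ} (hA : Tendsto (fun t => (kreal t : ℝ)) atTop (nhds A))
    (c : ℚ) (hc : 0 < c) (hc1 : c ≤ 1) :
    NHyp (fun t => c * kreal t) (c * A)
      (fun n t => c * (ksum (n + 1) t + 2 * (1 / 4) ^ (n + 1)))
      (fun n t => c * (((kcnt (n + 1) t : ℚ) + 1) * (2 * (1 / 4) ^ (n + 1)))) where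
  acomp := qmul (Computable.const c) computable_kreal
  amono := fun s t hst => mul_le_mul_of_nonneg_left (kreal_mono hst) hc.le
  atend := (hA.const_mul (c : ℝ)).congr fun t => by push_cast; rfl
  Rcomp := by
    have hn : Computable (fun p : ℕ × ℕ => p.1 + 1) := Computable.succ.comp Computable.fst
    exact qmul (Computable.const c) (qadd (computable_ksum.comp hn Computable.snd)
      (qmul (Computable.const 2) (qpow _ hn)))
  Rmono := fun n s t hst => by
    have := ksum_mono (n + 1) hst
    simp only
    gcongr
  C0 := fun n t => by positivity
  Cmono := fun n s t hst => by
    have : (kcnt (n + 1) s : ℚ) ≤ kcnt (n + 1) t := Nat.cast_le.2 (kcnt_mono (n + 1) hst)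
    simp only
    gcongr
  Cle := fun n t => by
    have h1 : (kcnt (n + 1) t : ℚ) ≤ (n + 1 : ℕ) := Nat.cast_le.2 (kcnt_le _ _)
    have h2 : n + 1 + 1 ≤ 2 ^ (n + 1) := Nat.lt_two_pow_self
    have h2' : (n : ℚ) + 1 + 1 ≤ 2 ^ (n + 1) := by exact_mod_cast h2
    push_cast at h1
    have h3 : (0 : ℚ) < (1 / 4) ^ (n + 1) := by positivity
    have h4 : ((kcnt (n + 1) t : ℚ) + 1) * (2 * (1 / 4) ^ (n + 1)) ≤ 
        2 ^ (n + 1) * (2 * (1 / 4) ^ (n + 1)) := by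
      apply mul_le_mul_of_nonneg_right _ (by positivity)
      linarith
    have h5 : (2 : ℚ) ^ (n + 1) * (2 * (1 / 4) ^ (n + 1)) = (1 / 2) ^ n := by
      have : (2 : ℚ) ^ (n + 1) * (1 / 4) ^ (n + 1) = (1 / 2) ^ (n + 1) := by
        rw [← mul_pow]; norm_num
      calc (2 : ℚ) ^ (n + 1) * (2 * (1 / 4) ^ (n + 1)) = 2 * (2 ^ (n + 1) * (1 / 4) ^ (n + 1)) := by ring
        _ = _ := by rw [this, pow_succ]; ring
    have h6 : (0 : ℚ) ≤ ((kcnt (n + 1) t : ℚ) + 1) * (2 * (1 / 4) ^ (n + 1)) := by positivity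
    nlinarith
  R0 := fun n => by
    have h1 := ksum_le (n + 1) 0
    have h2 : (0 : ℚ) < (1 / 4) ^ (n + 1) := by positivity
    have h3 : (0 : ℚ) ≤ (kcnt (n + 1) 0 : ℚ) := by positivity
    rw [← mul_sub]
    apply mul_le_mul_of_nonneg_left _ hc.le
    nlinarith
  Rstep := fun n t hne => by
    have h0 : ksum (n + 1) (t + 1) ≠ ksum (n + 1) t := fun h => hne (by simp only [h])
    have h1 := ksum_le (n + 1) (t + 1)
    have h2 : (0 : ℚ) < (1 / 4) ^ (n + 1) := by positivity
    have h3 : (kcnt (n + 1) t : ℚ) + 1 ≤ kcnt (n + 1) (t + 1) := by exact_mod_cast kcnt_step h0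
    rw [← mul_sub, ← mul_sub]
    apply mul_le_mul_of_nonneg_left _ hc.le
    nlinarith
  Rev := fun n => by
    have h2 : (0 : ℝ) < (1 / 4) ^ (n + 1) := by positivity
    obtain ⟨T, hT⟩ := ((tendsto_order.1 hA).1 (A - 1 / 2 * (1 / 4) ^ (n + 1)) (by linarith)).exists
    refine ⟨T, ?_⟩
    have h3 : (kreal T : ℝ) ≤ ((ksum (n + 1) T + 4 / 3 * (1 / 4) ^ (n + 1) : ℚ) : ℝ) :=
      Rat.cast_le.2 (kreal_le (n + 1) T)
    have hc' : (0 : ℝ) < c := Rat.cast_pos.2 hc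
    push_cast at h3 ⊢
    apply mul_lt_mul_of_pos_left _ hc'
    linarith

end Halting

/-! ## The dichotomy -/

section Dichotomy

variable (f a : ℕ → ℚ)

/-- Scaling constant at level `n`. -/
def cc (n : ℕ) : ℚ := (1 / 2) ^ (n + 1)

def ksStep (n t : ℕ) (p : ℚ × ℚ) : ℚ × ℚ :=
  if f (t + 1) ≤ p.1 then p else (f (t + 1) + cc n * (a (t + 1) - p.2), a (t + 1))

def ks (n t : ℕ) : ℚ × ℚ := Nat.rec (f 0, a 0) (fun t p => ksStep f a n t p) t

theorem ks_zero (n : ℕ) : ks f a n 0 = (f 0, a 0) := rfl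
theorem ks_succ (n t : ℕ) : ks f a n (t + 1) = ksStep f a n t (ks f a n t) := rfl

theorem ks_keep {n t : ℕ} (h : f (t + 1) ≤ (ks f a n t).1) : ks f a n (t + 1) = ks f a n t := by
  rw [ks_succ, ksStep, if_pos h]

theorem ks_upd {n t : ℕ} (h : ¬ f (t + 1) ≤ (ks f a n t).1) : ks f a n (t + 1) =
    (f (t + 1) + cc n * (a (t + 1) - (ks f a n t).2), a (t + 1)) := by
  rw [ks_succ, ksStep, if_neg h]

theorem cc_pos (n : ℕ) : 0 < cc n := by unfold cc; positivity

variable {f a}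

theorem computable_ks (hf : Computable f) (ha : Computable a) : Computable₂ (ks f a) := by
  refine Computable.nat_rec (f := fun p : ℕ × ℕ => p.2) (g := fun _ => (f 0, a 0))
    (h := fun p s => ksStep f a p.1 s.1 s.2) Computable.snd (Computable.const _) ?_
  have hn : Computable (fun x : (ℕ × ℕ) × ℕ × ℚ × ℚ => x.1.1) := Computable.fst.comp Computable.fst
  have ht : Computable (fun x : (ℕ × ℕ) × ℕ × ℚ × ℚ => x.2.1 + 1) :=
    Computable.succ.comp (Computable.fst.comp Computable.snd)
  have hp : Computable (fun x : (ℕ × ℕ) × ℕ × ℚ × ℚ => x.2.2) := Computable.snd.comp Computable.snd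
  refine comp_ite (c := fun x : (ℕ × ℕ) × ℕ × ℚ × ℚ => f (x.2.1 + 1) ≤ x.2.2.1)
    (qled (hf.comp ht) (Computable.fst.comp hp)) hp ?_
  refine Computable.pair (qadd (hf.comp ht) (qmul (qpow _ (Computable.succ.comp hn)) 
    (qsub (ha.comp ht) (Computable.snd.comp hp)))) (ha.comp ht)

theorem ks_le (ham : Monotone a) (n t : ℕ) : (ks f a n t).2 ≤ a t := by
  induction t with
  | zero => rw [ks_zero]
  | succ t ih =>
    by_cases h : f (t + 1) ≤ (ks f a n t).1
    · rw [ks_keep f a h]; exact ih.trans (ham (Nat.le_succ t))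
    · rw [ks_upd f a h]

theorem ks_snd_mono (ham : Monotone a) (n : ℕ) : Monotone fun t => (ks f a n t).2 := by
  refine monotone_nat_of_le_succ fun t => ?_
  by_cases h : f (t + 1) ≤ (ks f a n t).1
  · rw [ks_keep f a h]
  · rw [ks_upd f a h]; exact (ks_le ham n t).trans (ham (Nat.le_succ t))

theorem ks_fst_mono (ham : Monotone a) (n : ℕ) : Monotone fun t => (ks f a n t).1 := by
  refine monotone_nat_of_le_succ fun t => ?_
  by_cases h : f (t + 1) ≤ (ks f a n t).1
  · rw [ks_keep f a h]
  · rw [ks_upd f a h]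
    have h1 := (ks_le (f := f) ham n t).trans (ham (Nat.le_succ t))
    have h2 := mul_nonneg (cc_pos n).le (sub_nonneg.2 h1)
    push Not at h
    simp only [Nat.succ_eq_add_one] at h2 ⊢
    linarith

theorem ks_y_mono (n : ℕ) : Monotone fun t => (ks f a n t).1 - cc n * (ks f a n t).2 := by
  refine monotone_nat_of_le_succ fun t => ?_
  by_cases h : f (t + 1) ≤ (ks f a n t).1
  · rw [ks_keep f a h]
  · rw [ks_upd f a h]
    push Not at h
    simp only
    linarith

theorem ks_NHyp {α : ℝ} (hf : Computable f) (hfm : Monotone f)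
    (hft : Tendsto (fun t => (f t : ℝ)) atTop (nhds α)) (ha : Computable a) (ham : Monotone a)
    (ha0 : ∀ t, 0 ≤ a t) (ha2 : ∀ t, a t ≤ 2) (hev : ∀ n, ∃ T, α < (ks f a n T).1) :
    NHyp f α (fun n t => (ks f a n t).1) (fun n t => cc n * (ks f a n t).2) where
  acomp := hf
  amono := hfm
  atend := hft
  Rcomp := Computable.fst.comp (computable_ks hf ha)
  Rmono := fun n => ks_fst_mono ham n
  C0 := fun n t => by
    have h1 : (ks f a n 0).2 ≤ (ks f a n t).2 := ks_snd_mono ham n (Nat.zero_le t)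
    rw [ks_zero] at h1
    exact mul_nonneg (cc_pos n).le ((ha0 0).trans h1)
  Cmono := fun n s t hst => mul_le_mul_of_nonneg_left (ks_snd_mono ham n hst) (cc_pos n).le
  Cle := fun n t => by
    have h1 := mul_le_mul_of_nonneg_left ((ks_le (f := f) ham n t).trans (ha2 t)) (cc_pos n).le
    refine h1.trans (le_of_eq ?_)
    unfold cc; rw [pow_succ]; ring
  R0 := fun n => by
    rw [ks_zero]
    have := mul_nonneg (cc_pos n).le (ha0 0)
    simp only
    linarith
  Rstep := fun n t hne => by
    by_cases h : f (t + 1) ≤ (ks f a n t).1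
    · exact absurd (by rw [ks_keep f a h]) hne
    · rw [ks_upd f a h]
      simp only
      linarith
  Rev := hev

theorem ks_tendsto {α A : ℝ} {n : ℕ} (hfm : Monotone f)
    (hft : Tendsto (fun t => (f t : ℝ)) atTop (nhds α)) (ham : Monotone a)
    (hat : Tendsto (fun t => (a t : ℝ)) atTop (nhds A)) (haA : ∀ t, (a t : ℝ) ≤ A)
    (hlt : ∀ T, ((ks f a n T).1 : ℝ) < α) :
    Tendsto (fun t => (((ks f a n t).1 - cc n * (ks f a n t).2 : ℚ) : ℝ)) atTop
      (nhds (α - cc n * A)) := by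
  have key : ∀ s, ∃ t, ∀ u ≥ t, f s ≤ (ks f a n u).1 ∧ a s ≤ (ks f a n u).2 := by
    intro s
    have : ∃ t ≥ s, ¬ f (t + 1) ≤ (ks f a n t).1 := by
      by_contra hc
      push Not at hc
      have h1 : ∀ t ≥ s, ks f a n t = ks f a n s := by
        intro t ht
        induction t, ht using Nat.le_induction with
        | base => rfl
        | succ t ht ih => rw [ks_keep f a (hc t ht), ih]
      have h2 : α ≤ (ks f a n s).1 := by
        refine le_of_tendsto hft ?_
        filter_upwards [eventually_ge_atTop (s + 1)] with t ht
        obtain ⟨u, rfl⟩ : ∃ u, t = u + 1 := ⟨t - 1, by omega⟩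
        have := hc u (by omega)
        rw [h1 u (by omega)] at this
        exact Rat.cast_le.2 this
      linarith [hlt s]
    obtain ⟨t, ht, hn⟩ := this
    refine ⟨t + 1, fun u hu => ⟨?_, ?_⟩⟩
    · refine le_trans ?_ (ks_fst_mono ham n hu)
      simp only
      rw [ks_upd f a hn]
      have h1 := (ks_le (f := f) ham n t).trans (ham (Nat.le_succ t))
      have h2 := mul_nonneg (cc_pos n).le (sub_nonneg.2 h1)
      have h3 := hfm (show s ≤ t + 1 by omega)
      simp only [Nat.succ_eq_add_one] at h2 ⊢
      linarith
    · refine le_trans ?_ (ks_snd_mono ham n hu)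
      simp only
      rw [ks_upd f a hn]
      exact ham (by omega)
  have h1 : Tendsto (fun t => ((ks f a n t).1 : ℝ)) atTop (nhds α) := by
    refine tendsto_order.2 ⟨fun y hy => ?_, fun y hy => Eventually.of_forall fun t => (hlt t).trans hy⟩
    obtain ⟨s, hs⟩ := ((tendsto_order.1 hft).1 y hy).exists
    obtain ⟨t, ht⟩ := key s
    filter_upwards [eventually_ge_atTop t] with u hu
    exact hs.trans_le (Rat.cast_le.2 (ht u hu).1)
  have h2 : Tendsto (fun t => ((ks f a n t).2 : ℝ)) atTop (nhds A) := by
    refine tendsto_order.2 ⟨fun y hy => ?_, fun y hy => Eventually.of_forall fun t => ?_⟩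
    · obtain ⟨s, hs⟩ := ((tendsto_order.1 hat).1 y hy).exists
      obtain ⟨t, ht⟩ := key s
      filter_upwards [eventually_ge_atTop t] with u hu
      exact hs.trans_le (Rat.cast_le.2 (ht u hu).2)
    · exact ((Rat.cast_le.2 (ks_le ham n t)).trans (haA t)).trans_lt hy
  exact (h1.sub (h2.const_mul (cc n : ℝ))).congr fun t => by push_cast; rfl

theorem main_thm (α : ℝ) (hα : LeftCE α) (hnc : ¬ ComputableReal α) :
    ∃ β : ℝ, LeftCE β ∧ ¬ LeftCE (α - β) ∧ ¬ RightCE (α - β) := by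
  obtain ⟨f, hf, hfm, hft⟩ := hα
  obtain ⟨A, hA, hAle⟩ := exists_kreal_lim
  by_cases hev : ∀ n, ∃ T, α ≤ (ks f kreal n T).1
  · have hN := ks_NHyp hf hfm.monotone hft computable_kreal kreal_mono kreal_nonneg kreal_le_two
      (fun n => by
        obtain ⟨T, hT⟩ := hev n
        refine ⟨T, lt_of_le_of_ne hT fun h => hnc ?_⟩
        rw [h]
        exact computableReal_rat _)
    obtain ⟨β, b, hb, hbm, hbt, h1, h2⟩ := hN.main hnc
    exact ⟨β, leftCE_of_mono hb hbm hbt, h1, h2⟩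
  · push Not at hev
    obtain ⟨n, hn⟩ := hev
    have hy := ks_tendsto hfm.monotone hft kreal_mono hA hAle hn
    have hN := kreal_NHyp hA (cc n) (cc_pos n) (pow_le_one₀ (by norm_num) (by norm_num))
    obtain ⟨β, b, hb, hbm, hbt, h1, h2⟩ := hN.main (kreal_noncomputable hA hAle _ (cc_pos n))
    refine ⟨(α - cc n * A) + β, ?_, ?_, ?_⟩
    · have hks : Computable (fun t => ks f kreal n t) :=
        (computable_ks hf computable_kreal).comp (Computable.const n) Computable.id
      refine leftCE_of_mono (f := fun t => ((ks f kreal n t).1 - cc n * (ks f kreal n t).2) + b t)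
        (qadd (qsub (Computable.fst.comp hks) (qmul (Computable.const _) (Computable.snd.comp hks))) hb)
        (fun s t hst => add_le_add (ks_y_mono n hst) (hbm hst)) ?_
      exact (hy.add hbt).congr fun t => by push_cast; rfl
    · have : α - ((α - cc n * A) + β) = cc n * A - β := by ring
      rw [this]; exact h1
    · have : α - ((α - cc n * A) + β) = cc n * A - β := by ring
      rw [this]; exact h2

end Dichotomy

theorem statement1 (α : ℝ) (hα : LeftCE α) (hnc : ¬ ComputableReal α)
    (hnr : ¬ MLRandom α) :
    ∃ β : ℝ, LeftCE β ∧ ¬ MLRandom β ∧ ¬ LeftCE (α - β) ∧ ¬ RightCE (α - β) := by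
  obtain ⟨β, h1, h2, h3⟩ := main_thm α hα hnc
  exact ⟨β, h1, not_mlrandom β, h2, h3⟩
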